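/- arXiv:2204.12925 — 9 statements merged into one kernel-verified Lean document; each statement's English description precedes it below -/
import Mathlib

section
/- Let w be a complex number with sin(w) ≠ 0. Then the series ∑_{n∈ℤ} 1/(πn − w)² converges absolutely and ∑_{n∈ℤ} 1/(πn − w)² = 1/sin²(w). -/
open Complex Real

lemma aux_sum (x : ℂ) : Summable (fun n : ℤ => 1 / (x - n) ^ 2) := by
  have h := EisensteinSeries.linear_right_summable x (-1) (k := 2) (by norm_num)
  refine h.congr fun n => ?_
  rw [one_div]
  congr 1
  norm_cast
  push_cast
  ring

lemma aux_main (x : ℂ) (hx : ∀ n : ℤ, x ≠ n) :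
    ∑' n : ℤ, 1 / (x - n) ^ 2 = π ^ 2 / Complex.sin (π * x) ^ 2 := by
  have hmem : x ∈ Complex.integerComplement := by
    rw [Complex.mem_integerComplement_iff]; rintro ⟨n, hn⟩; exact hx n hn.symm
  have ho : IsOpen Complex.integerComplement := Complex.isOpen_compl_range_intCast
  obtain ⟨e, he, hb⟩ := Metric.isOpen_iff.1 ho x hmem
  have hne : ∀ y ∈ Complex.integerComplement, ∀ n : ℤ, y - n ≠ 0 := by
    intro y hy n h
    rw [Complex.mem_integerComplement_iff] at hy
    exact hy ⟨n, (sub_eq_zero.1 h).symm⟩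
  have hdist : ∀ n : ℤ, e ≤ ‖x - n‖ := by
    intro n
    by_contra! h
    have := hne n (hb (by rw [Metric.mem_ball, dist_comm, dist_eq_norm]; exact h)) n
    simp at this
  have hbd : ∀ y ∈ Metric.ball x (e/2), ∀ n : ℤ, ‖1 / (y - n) ^ 2‖ ≤ 4 * ‖1 / (x - n) ^ 2‖ := by
    intro y hy n
    have h1 := hdist n
    rw [Metric.mem_ball, dist_comm, dist_eq_norm] at hy
    have h2 : ‖x - n‖ ≤ ‖x - y‖ + ‖y - n‖ := by
      calc _ = ‖(x - y) + (y - n)‖ := by ring_nf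
        _ ≤ _ := norm_add_le _ _
    have h3 : ‖x - n‖ / 2 ≤ ‖y - n‖ := by linarith
    have h4 : 0 < ‖x - n‖ := by linarith
    rw [norm_div, norm_div, norm_pow, norm_pow, norm_one]
    calc 1 / ‖y - n‖ ^ 2 ≤ 1 / (‖x - n‖ / 2) ^ 2 := by gcongr
      _ = _ := by field_simp; norm_num
  have hS := aux_sum x
  have hS1 : Summable (fun n : ℕ => 1 / (x - ((n + 1 : ℕ) : ℤ)) ^ 2) :=
    hS.comp_injective (i := fun n : ℕ => ((n + 1 : ℕ) : ℤ)) (fun a b h => by simpa using h)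
  have hS2 : Summable (fun n : ℕ => 1 / (x - (-((n + 1 : ℕ) : ℤ) : ℤ)) ^ 2) :=
    hS.comp_injective (i := fun n : ℕ => (-((n + 1 : ℕ) : ℤ) : ℤ)) (fun a b h => by simpa using h)
  have hsub : ∀ y ∈ Metric.ball x (e/2), y ∈ Complex.integerComplement := fun y hy =>
    hb (Metric.ball_subset_ball (by linarith) hy)
  have hd : ∀ (y : ℂ) (n : ℤ), y ∈ Metric.ball x (e/2) →
      HasDerivAt (fun z : ℂ => 1 / (z - n)) (-(1 / (y - n) ^ 2)) y := by
    intro y n hy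
    have := ((hasDerivAt_id y).sub_const (n : ℂ)).inv (hne y (hsub y hy) n)
    have h2 : HasDerivAt (fun z : ℂ => (z - n)⁻¹) (-1 / (y - n) ^ 2) y := this
    simpa [neg_div] using h2
  have key := hasDerivAt_tsum_of_isPreconnected
    (g := fun (n : ℕ) (z : ℂ) => 1 / (z - ((n + 1 : ℕ) : ℤ)) + 1 / (z - (-((n + 1 : ℕ) : ℤ) : ℤ)))
    (g' := fun (n : ℕ) (z : ℂ) => -(1 / (z - ((n + 1 : ℕ) : ℤ)) ^ 2)
      + -(1 / (z - (-((n + 1 : ℕ) : ℤ) : ℤ)) ^ 2))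
    (((hS1.norm.mul_left 4).add (hS2.norm.mul_left 4)))
    (Metric.isOpen_ball (x := x) (ε := e/2)) (convex_ball x (e/2)).isPreconnected
    (fun n y hy => (hd y _ hy).add (hd y _ hy))
    (fun n y hy => (norm_add_le _ _).trans (by
      rw [norm_neg, norm_neg]; exact add_le_add (hbd y hy _) (hbd y hy _)))
    (Metric.mem_ball_self (by positivity)) (by simpa [sub_eq_add_neg, add_comm] using! summable_cotTerm hmem)
    (Metric.mem_ball_self (by positivity))
  have hsin : Complex.sin (π * x) ≠ 0 := sin_pi_mul_ne_zero hmem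
  have hx0 : x ≠ 0 := by simpa using hx 0
  have hcot : HasDerivAt (fun z : ℂ => π * Complex.cot (π * z) - 1 / z)
      (-(π ^ 2 / Complex.sin (π * x) ^ 2) + 1 / x ^ 2) x := by
    have hl : HasDerivAt (fun z : ℂ => (π : ℂ) * z) π x := by
      simpa using (hasDerivAt_id x).const_mul (π : ℂ)
    have h1 := ((hl.ccos.div hl.csin hsin).const_mul (π : ℂ)).sub (hasDerivAt_inv hx0)
    have h2 : (fun z : ℂ => π * Complex.cot (π * z) - 1 / z) =
      ((fun y => ↑π * ((fun x => Complex.cos (↑π * x)) / fun x => Complex.sin (↑π * x)) y)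
        - fun y => y⁻¹) := by
      ext z; simp [Complex.cot]
    have h3 : -((π : ℂ) ^ 2 / Complex.sin (↑π * x) ^ 2) + 1 / x ^ 2 =
      ↑π * ((-Complex.sin (↑π * x) * ↑π * Complex.sin (↑π * x)
        - Complex.cos (↑π * x) * (Complex.cos (↑π * x) * ↑π)) / Complex.sin (↑π * x) ^ 2)
        - -(x ^ 2)⁻¹ := by
      have := Complex.sin_sq_add_cos_sq (π * x)
      have h4 : -Complex.sin (↑π * x) * ↑π * Complex.sin (↑π * x)
        - Complex.cos (↑π * x) * (Complex.cos (↑π * x) * ↑π) = -π := by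
        linear_combination (-π : ℂ) * this
      rw [h4]
      ring
    rw [h2, h3]
    exact h1
  have heq : (fun z : ℂ => π * Complex.cot (π * z) - 1 / z) =ᶠ[nhds x]
      fun z => ∑' n : ℕ, (1 / (z - ((n + 1 : ℕ) : ℤ)) + 1 / (z - (-((n + 1 : ℕ) : ℤ) : ℤ))) := by
    filter_upwards [ho.mem_nhds hmem] with z hz
    simpa [sub_eq_add_neg, add_comm] using cot_series_rep' hz
  have huniq := (hcot.congr_of_eventuallyEq heq.symm).unique key
  rw [Summable.tsum_add hS1.neg hS2.neg, tsum_neg, tsum_neg] at huniq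
  rw [tsum_of_add_one_of_neg_add_one (by simpa using hS1) (by simpa using hS2)]
  push_cast at huniq ⊢
  simp only [sub_zero] at huniq ⊢
  linear_combination huniq

/-- For a complex number `w` with `sin w ≠ 0`, the series `∑_{n ∈ ℤ} 1/(πn - w)²`
converges absolutely and equals `1/sin² w`. -/
theorem sum_inv_sq_pi_int_sub (w : ℂ) (hw : Complex.sin w ≠ 0) :
    Summable (fun n : ℤ => 1 / ((Real.pi : ℂ) * n - w) ^ 2) ∧
    ∑' n : ℤ, 1 / ((Real.pi : ℂ) * n - w) ^ 2 = 1 / Complex.sin w ^ 2 := by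
  have hpi : (π : ℂ) ≠ 0 := by exact_mod_cast Real.pi_ne_zero
  have hf : (fun n : ℤ => 1 / ((Real.pi : ℂ) * n - w) ^ 2) =
      fun n : ℤ => (1 / (π : ℂ) ^ 2) * (1 / (w / π - n) ^ 2) := by
    ext n
    rw [one_div_mul_one_div, ← mul_pow, mul_sub, mul_div_cancel₀ _ hpi]
    congr 1
    ring
  rw [hf]
  refine ⟨(aux_sum _).mul_left _, ?_⟩
  rw [tsum_mul_left, aux_main, mul_div_cancel₀ _ hpi]
  · field_simp
  · intro n h
    apply hw
    rw [div_eq_iff hpi] at h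
    rw [h, Complex.sin_int_mul_pi]
end

section
/- Let r₁,…,r_p and s₁,…,s_q be (not necessarily distinct) nonzero complex numbers, none of which is a positive integer, satisfying ∑_{i=1}^p r_i = ∑_{j=1}^q s_j. Then the infinite product ∏_{n=1}^∞ [∏_{i=1}^p (1 − r_i/n)] / [∏_{j=1}^q (1 − s_j/n)] converges and equals ∏_{j=1}^q Γ(1 − s_j) / ∏_{i=1}^p Γ(1 − r_i). -/
open Complex

open Filter Topology in
lemma aux_summable (z : ℂ) :
    Summable (fun n : ℕ => Complex.log (1 - z / ((n + 1 : ℕ) : ℂ)) + z / ((n + 1 : ℕ) : ℂ)) := by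
  have ht : Tendsto (fun n : ℕ => -(z / ((n + 1 : ℕ) : ℂ))) atTop (𝓝 0) := by
    have := (tendsto_add_atTop_iff_nat 1).2 (tendsto_const_div_atTop_nhds_zero_nat z)
    simpa using this.neg
  have h := Complex.log_sub_self_isBigO.comp_tendsto ht
  have hs : Summable (fun n : ℕ => (1 : ℝ) / ((n + 1 : ℕ) : ℝ) ^ 2) :=
    (summable_nat_add_iff 1).2 (Real.summable_one_div_nat_pow.2 (by norm_num))
  refine summable_of_isBigO_nat hs ?_
  have h2 : (fun n : ℕ => (-(z / ((n + 1 : ℕ) : ℂ))) ^ 2)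
      =O[atTop] (fun n : ℕ => (1 : ℝ) / ((n + 1 : ℕ) : ℝ) ^ 2) := by
    refine Asymptotics.IsBigO.of_bound (‖z‖ ^ 2) (Eventually.of_forall fun n => ?_)
    rw [norm_pow, norm_neg, norm_div, Complex.norm_natCast, norm_div, norm_pow, norm_one,
      Real.norm_natCast, div_pow, mul_one_div]
  refine (h.trans h2).congr_left fun n => ?_
  simp only [Function.comp]
  rw [← sub_eq_add_neg, sub_neg_eq_add]

open Filter Topology in
lemma aux_tendsto (z : ℂ) (hz : ∀ n : ℕ, 0 < n → z ≠ (n : ℂ)) :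
    Tendsto (fun N : ℕ => (N : ℂ) ^ z * ∏ m ∈ Finset.range N, (1 - z / ((m + 1 : ℕ) : ℂ))) atTop
      (𝓝 (Complex.Gamma (1 - z))⁻¹) := by
  have hG : Complex.Gamma (1 - z) ≠ 0 := by
    apply Complex.Gamma_ne_zero
    intro m h
    apply hz (m + 1) (Nat.succ_pos m)
    push_cast
    linear_combination -h
  have h1 := (Complex.GammaSeq_tendsto_Gamma (1 - z)).inv₀ hG
  have h2 : Tendsto (fun N : ℕ => (N : ℂ) / (N + (1 - z))) atTop (𝓝 1) :=
    tendsto_natCast_div_add_atTop (1 - z)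
  have h3 := h2.mul h1
  rw [one_mul] at h3
  refine h3.congr' ?_
  filter_upwards [eventually_gt_atTop 0] with N hN
  have hN0 : (N : ℂ) ≠ 0 := by exact_mod_cast hN.ne'
  have hne : ∀ m : ℕ, (1 - z + m) ≠ 0 := by
    intro m h
    apply hz (m + 1) (Nat.succ_pos m)
    push_cast
    linear_combination -h
  have hprod : ∏ m ∈ Finset.range N, (1 - z / ((m + 1 : ℕ) : ℂ))
      = (∏ m ∈ Finset.range N, (1 - z + m)) / (N.factorial : ℂ) := by
    rw [← Finset.prod_range_add_one_eq_factorial, Nat.cast_prod, ← Finset.prod_div_distrib]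
    refine Finset.prod_congr rfl fun m _ => ?_
    have : ((m + 1 : ℕ) : ℂ) ≠ 0 := by exact_mod_cast m.succ_ne_zero
    field_simp
    push_cast
    ring
  have hf : (N.factorial : ℂ) ≠ 0 := by exact_mod_cast N.factorial_ne_zero
  have hp : (N : ℂ) ^ z ≠ 0 := by simp [Complex.cpow_eq_zero_iff, hN0]
  rw [hprod, Complex.GammaSeq, Finset.prod_range_succ, Complex.cpow_sub _ _ hN0, Complex.cpow_one]
  have hN1 := hne N
  have hN2 : (N : ℂ) + (1 - z) ≠ 0 := by rwa [add_comm]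
  have hP : ∏ m ∈ Finset.range N, (1 - z + (m : ℂ)) ≠ 0 := Finset.prod_ne_zero_iff.2 fun m _ => hne m
  rw [add_comm (N : ℂ)]
  field_simp

/-- If `r₁,…,r_p` and `s₁,…,s_q` are nonzero complex numbers, none a positive integer,
with `∑ rᵢ = ∑ sⱼ`, then `∏_{n=1}^∞ (∏ᵢ (1 - rᵢ/n)) / (∏ⱼ (1 - sⱼ/n))` converges and
equals `∏ⱼ Γ(1 - sⱼ) / ∏ᵢ Γ(1 - rᵢ)`. -/
theorem infinite_prod_ratio_polynomials_eq_Gamma (p q : ℕ) (r : Fin p → ℂ) (s : Fin q → ℂ)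
    (hr0 : ∀ i, r i ≠ 0) (hs0 : ∀ j, s j ≠ 0)
    (hrn : ∀ i, ∀ n : ℕ, 0 < n → r i ≠ (n : ℂ))
    (hsn : ∀ j, ∀ n : ℕ, 0 < n → s j ≠ (n : ℂ))
    (hsum : ∑ i, r i = ∑ j, s j) :
    Multipliable (fun n : ℕ+ =>
      (∏ i, (1 - r i / (n : ℂ))) / (∏ j, (1 - s j / (n : ℂ)))) ∧
    ∏' n : ℕ+, (∏ i, (1 - r i / (n : ℂ))) / (∏ j, (1 - s j / (n : ℂ)))
      = (∏ j, Complex.Gamma (1 - s j)) / (∏ i, Complex.Gamma (1 - r i)) := by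
  have key : HasProd (fun n : ℕ+ =>
      (∏ i, (1 - r i / (n : ℂ))) / (∏ j, (1 - s j / (n : ℂ))))
      ((∏ j, Complex.Gamma (1 - s j)) / (∏ i, Complex.Gamma (1 - r i))) := by
    rw [hasProd_pnat_iff_hasProd_succ (f := fun n : ℕ =>
      (∏ i, (1 - r i / (n : ℂ))) / (∏ j, (1 - s j / (n : ℂ))))]
    have hne : ∀ z : ℂ, (∀ n : ℕ, 0 < n → z ≠ (n : ℂ)) → ∀ n : ℕ,
        1 - z / ((n + 1 : ℕ) : ℂ) ≠ 0 := by
      intro z hz n h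
      have h0 : ((n + 1 : ℕ) : ℂ) ≠ 0 := by exact_mod_cast n.succ_ne_zero
      apply hz (n + 1) n.succ_pos
      rw [sub_eq_zero, eq_div_iff h0, one_mul] at h
      exact h.symm
    have hm : Multipliable (fun n : ℕ =>
        (∏ i, (1 - r i / ((n + 1 : ℕ) : ℂ))) / (∏ j, (1 - s j / ((n + 1 : ℕ) : ℂ)))) := by
      have hS := (summable_sum (s := Finset.univ) fun i _ => aux_summable (r i)).sub
        (summable_sum (s := Finset.univ) fun j _ => aux_summable (s j))
      refine hS.hasSum.cexp.multipliable.congr fun n => ?_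
      simp only [Function.comp, Finset.sum_add_distrib, ← Finset.sum_div, hsum,
        add_sub_add_right_eq_sub, Complex.exp_sub, Complex.exp_sum]
      congr 1
      · exact Finset.prod_congr rfl fun i _ => Complex.exp_log (hne _ (hrn i) n)
      · exact Finset.prod_congr rfl fun i _ => Complex.exp_log (hne _ (hsn i) n)
    rw [hm.hasProd_iff_tendsto_nat]
    have hr := tendsto_finset_prod Finset.univ fun i _ => aux_tendsto (r i) (hrn i)
    have hs := tendsto_finset_prod Finset.univ fun j _ => aux_tendsto (s j) (hsn j)
    have hG : ∏ j, (Complex.Gamma (1 - s j))⁻¹ ≠ 0 := by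
      refine Finset.prod_ne_zero_iff.2 fun j _ => inv_ne_zero (Complex.Gamma_ne_zero ?_)
      intro m h
      apply hsn j (m + 1) (Nat.succ_pos m)
      push_cast
      linear_combination -h
    have hd := hr.div hs hG
    rw [Finset.prod_inv_distrib, Finset.prod_inv_distrib, inv_div_inv] at hd
    refine hd.congr' ?_
    filter_upwards [Filter.eventually_gt_atTop 0] with N hN
    have hN0 : (N : ℂ) ≠ 0 := by exact_mod_cast hN.ne'
    have hpow : ∀ (k : ℕ) (t : Fin k → ℂ), ∏ i, (N : ℂ) ^ t i = (N : ℂ) ^ ∑ i, t i := by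
      intro k t
      simp only [Complex.cpow_def_of_ne_zero hN0]
      rw [Finset.mul_sum, Complex.exp_sum]
    have hp : (N : ℂ) ^ (∑ j, s j) ≠ 0 := by simp [Complex.cpow_eq_zero_iff, hN0]
    simp only [Pi.div_apply]
    rw [Finset.prod_mul_distrib, Finset.prod_mul_distrib, hpow, hpow, hsum,
      mul_div_mul_left _ _ hp, Finset.prod_div_distrib, Finset.prod_comm,
      Finset.prod_comm (s := Finset.univ) (t := Finset.range N)]
  exact ⟨key.multipliable, key.tprod_eq⟩
end

section
/- Let r₁,…,r_p and s₁,…,s_q be (not necessarily distinct) nonzero complex numbers with ∑_{i=1}^p r_i = ∑_{j=1}^q s_j. Suppose r₁ = k where k is a positive integer, and that none of r₂,…,r_p, s₁,…,s_q is a positive integer (in particular none equals k). Then ∏_{n=1, n≠k}^∞ [∏_{i=1}^p (1 − r_i/n)] / [∏_{j=1}^q (1 − s_j/n)] = (−1)^{k−1} · k^{p−q} · (k−1)! · [∏_{j=1}^q (k − s_j)Γ(1 − s_j)] / [∏_{i=2}^p (k − r_i)Γ(1 − r_i)]. -/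
open Complex

lemma aux_cpow_sum {ι : Type*} (t : Finset ι) (r : ι → ℂ) (x : ℂ) (hx : x ≠ 0) :
    ∏ i ∈ t, x ^ (r i) = x ^ (∑ i ∈ t, r i) := by
  classical
  induction t using Finset.induction_on with
  | empty => simp
  | insert a t ha ih =>
    rw [Finset.prod_insert ha, Finset.sum_insert ha, ih, cpow_add _ _ hx]

open Filter Topology Asymptotics in
lemma aux_prod_bigO {ι : Type*} [DecidableEq ι] (t : Finset ι) (r : ι → ℂ) :
    (fun x : ℂ => ∏ i ∈ t, (1 - r i * x) - 1 + (∑ i ∈ t, r i) * x) =O[𝓝 0] (fun x => x ^ 2) := by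
  induction t using Finset.induction_on with
  | empty => simpa using isBigO_zero _ _
  | insert a t ha ih =>
    have h1 : (fun x : ℂ => (1 - r a * x)) =O[𝓝 0] (fun _ => (1 : ℂ)) := by
      have : Tendsto (fun x : ℂ => (1 - r a * x)) (𝓝 0) (𝓝 (1 - r a * 0)) :=
        Continuous.tendsto (by fun_prop) 0
      exact this.isBigO_one ℂ
    have h2 := h1.mul ih
    have h3 : (fun x : ℂ => (r a * ∑ i ∈ t, r i) * x ^ 2) =O[𝓝 0] (fun x => x ^ 2) :=
      isBigO_const_mul_self _ _ _
    simp only [one_mul] at h2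
    refine (h2.add h3).congr_left ?_
    intro x
    rw [Finset.prod_insert ha, Finset.sum_insert ha]
    ring

open Filter Topology Asymptotics in
lemma aux_quot_bigO {p q : ℕ} (r : Fin p → ℂ) (s : Fin q → ℂ) (h : ∑ i, r i = ∑ j, s j) :
    (fun x : ℂ => (∏ i, (1 - r i * x)) / (∏ j, (1 - s j * x)) - 1) =O[𝓝 0] (fun x => x ^ 2) := by
  have h1 := (aux_prod_bigO Finset.univ r).sub (aux_prod_bigO Finset.univ s)
  have hq : Tendsto (fun x : ℂ => ∏ j, (1 - s j * x)) (𝓝 0) (𝓝 1) := by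
    have : Tendsto (fun x : ℂ => ∏ j, (1 - s j * x)) (𝓝 0) (𝓝 (∏ j, (1 - s j * 0))) :=
      Continuous.tendsto (by fun_prop) 0
    simpa using this
  have h2 : (fun x : ℂ => (∏ j, (1 - s j * x))⁻¹) =O[𝓝 0] (fun _ => (1 : ℂ)) :=
    (hq.inv₀ one_ne_zero).isBigO_one ℂ
  have h3 := h1.mul h2
  simp only [mul_one] at h3
  refine h3.congr' ?_ EventuallyEq.rfl
  filter_upwards [hq.eventually_ne one_ne_zero] with x hx
  rw [h, div_sub_one hx, div_eq_mul_inv]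
  congr 1
  ring

open Filter Topology in
lemma aux_lim (z : ℂ) (hz0 : z ≠ 0) (hz : ∀ n : ℕ, 0 < n → z ≠ n) :
    Tendsto (fun N : ℕ => (∏ n ∈ Finset.range N, (1 - z / ((n : ℂ) + 1))) * (N : ℂ) ^ z) atTop
      (𝓝 (Gamma (1 - z))⁻¹) := by
  have hm : ∀ m : ℕ, -z ≠ -m := by
    intro m hm
    rcases Nat.eq_zero_or_pos m with rfl | h
    · simp at hm; exact hz0 hm
    · exact hz m h (neg_injective hm)
  have hG : Gamma (-z) ≠ 0 := Gamma_ne_zero hm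
  have hG1 : Gamma (1 - z) = -z * Gamma (-z) := by
    rw [← Gamma_add_one _ (neg_ne_zero.2 hz0)]; congr 1; ring
  have h := ((GammaSeq_tendsto_Gamma (-z)).const_mul (-z)).inv₀
    (mul_ne_zero (neg_ne_zero.2 hz0) hG)
  rw [hG1]
  refine h.congr' ?_
  filter_upwards [eventually_gt_atTop 0] with N hN
  have hNc : (N : ℂ) ≠ 0 := by exact_mod_cast hN.ne'
  have key : (∏ n ∈ Finset.range N, (1 - z / ((n : ℂ) + 1))) * (Nat.factorial N : ℂ)
      = ∏ n ∈ Finset.range N, (-z + ((n + 1 : ℕ) : ℂ)) := by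
    rw [← Finset.prod_range_add_one_eq_factorial]
    push_cast
    rw [← Finset.prod_mul_distrib]
    refine Finset.prod_congr rfl fun n _ => ?_
    have : (n : ℂ) + 1 ≠ 0 := by exact_mod_cast Nat.succ_ne_zero n
    field_simp
    ring
  have hf : (Nat.factorial N : ℂ) ≠ 0 := by exact_mod_cast N.factorial_ne_zero
  have hpw : (N : ℂ) ^ z ≠ 0 := by simp [cpow_eq_zero_iff, hNc]
  rw [GammaSeq, Finset.prod_range_succ', ← key, cpow_neg]
  push_cast
  have hP : (∏ n ∈ Finset.range N, (1 - z / ((n : ℂ) + 1))) ≠ 0 := by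
    intro h0
    rw [h0, zero_mul] at key
    obtain ⟨n, -, hn⟩ := Finset.prod_eq_zero_iff.1 key.symm
    exact hz (n + 1) n.succ_pos (by linear_combination -hn)
  rw [add_zero]
  field_simp

lemma aux_ite (k : ℕ) (hk : 0 < k) (f : ℕ → ℂ) (N : ℕ) (hN : k ≤ N) :
    (∏ n ∈ Finset.range N, (if n + 1 = k then 1 else f n)) * f (k - 1)
      = ∏ n ∈ Finset.range N, f n := by
  have hm : k - 1 ∈ Finset.range N := by simp; omega
  rw [← Finset.mul_prod_erase _ f hm, ← Finset.mul_prod_erase _ _ hm, if_pos (by omega), one_mul,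
    mul_comm]
  congr 1
  refine Finset.prod_congr rfl fun n hn => ?_
  rw [if_neg]
  have := (Finset.mem_erase.1 hn).1
  omega

open Filter Topology in
lemma aux_lim1 (k : ℕ) (hk : 0 < k) (z : ℂ) (hz0 : z ≠ 0) (hz : ∀ n : ℕ, 0 < n → z ≠ n) :
    Tendsto (fun N : ℕ => (∏ n ∈ Finset.range N, (if n + 1 = k then 1 else (1 - z / ((n : ℂ) + 1))))
      * (N : ℂ) ^ z) atTop (𝓝 (k * ((k - z) * Gamma (1 - z))⁻¹)) := by
  have hkc : (k : ℂ) ≠ 0 := by exact_mod_cast hk.ne'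
  have hkz : (k : ℂ) - z ≠ 0 := sub_ne_zero.2 (hz k hk).symm
  have h := (aux_lim z hz0 hz).const_mul (k / (k - z))
  have e : (k : ℂ) * ((k - z) * Gamma (1 - z))⁻¹ = k / (k - z) * (Gamma (1 - z))⁻¹ := by
    rw [mul_inv]; ring
  rw [e]
  refine h.congr' ?_
  filter_upwards [eventually_ge_atTop k] with N hN
  rw [← aux_ite k hk _ N hN]
  have : ((k - 1 : ℕ) : ℂ) + 1 = k := by exact_mod_cast Nat.sub_add_cancel hk
  rw [this]
  field_simp

open Filter Topology in
lemma aux_lim2 (k : ℕ) (hk : 0 < k) :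
    Tendsto (fun N : ℕ => (∏ n ∈ Finset.range N,
      (if n + 1 = k then 1 else (1 - (k : ℂ) / ((n : ℂ) + 1))))
      * (N : ℂ) ^ (k : ℂ)) atTop (𝓝 ((-1) ^ (k - 1) * (Nat.factorial k : ℂ))) := by
  have hkc : (k : ℂ) ≠ 0 := by exact_mod_cast hk.ne'
  have h := aux_lim (-(k : ℂ)) (neg_ne_zero.2 hkc) (by
    intro n hn h
    have : ((n + k : ℕ) : ℂ) = 0 := by push_cast; rw [← h]; ring
    have := Nat.cast_eq_zero.1 this
    omega)
  rw [sub_neg_eq_add, add_comm, Gamma_nat_eq_factorial] at h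
  have hf : (Nat.factorial k : ℂ) ≠ 0 := by exact_mod_cast k.factorial_ne_zero
  have h2 := h.inv₀ (inv_ne_zero hf)
  rw [inv_inv] at h2
  have h3 : Tendsto (fun M : ℕ => (1 + (k : ℂ) / M) ^ k) atTop (𝓝 1) := by
    have : Tendsto (fun M : ℕ => (k : ℂ) / M) atTop (𝓝 0) := tendsto_const_div_atTop_nhds_zero_nat _
    simpa using (this.const_add 1).pow k
  have h4 := (h2.mul h3).const_mul ((-1 : ℂ) ^ (k - 1))
  rw [mul_one] at h4
  rw [← tendsto_add_atTop_iff_nat k]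
  refine h4.congr' ?_
  filter_upwards [eventually_gt_atTop 0] with M hM
  have hMc : (M : ℂ) ≠ 0 := by exact_mod_cast hM.ne'
  obtain ⟨l, rfl⟩ : ∃ l, k = l + 1 := ⟨k - 1, by omega⟩
  rw [add_comm M, Finset.prod_range_add, Finset.prod_range_succ, if_pos rfl, mul_one]
  have e1 : ∏ n ∈ Finset.range l, (if n + 1 = l + 1 then 1 else
      (1 - ((l + 1 : ℕ) : ℂ) / ((n : ℂ) + 1))) = (-1) ^ l := by
    have hfl : (∏ n ∈ Finset.range l, ((n : ℂ) + 1)) ≠ 0 := by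
      refine Finset.prod_ne_zero_iff.2 fun n _ => ?_
      exact_mod_cast Nat.succ_ne_zero n
    apply mul_right_cancel₀ hfl
    rw [← Finset.prod_mul_distrib]
    rw [← Finset.prod_range_reflect (fun n : ℕ => (n : ℂ) + 1) l]
    have : ((-1 : ℂ)) ^ l = ∏ n ∈ Finset.range l, (-1 : ℂ) := by simp
    rw [this, ← Finset.prod_mul_distrib]
    refine Finset.prod_congr rfl fun n hn => ?_
    have hn' := Finset.mem_range.1 hn
    rw [if_neg (by omega)]
    have h0 : (n : ℂ) + 1 ≠ 0 := by exact_mod_cast Nat.succ_ne_zero n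
    have : ((l - 1 - n : ℕ) : ℂ) + 1 = l - n := by
      have : (l - 1 - n) + 1 + n = l := by omega
      rw [eq_sub_iff_add_eq]
      exact_mod_cast this
    rw [this]
    push_cast
    field_simp
    ring
  have e2 : ∏ x ∈ Finset.range M, (if l + 1 + x + 1 = l + 1 then 1 else
      (1 - ((l + 1 : ℕ) : ℂ) / (((l + 1 + x : ℕ) : ℂ) + 1)))
      = (∏ n ∈ Finset.range M, (1 - -((l + 1 : ℕ) : ℂ) / ((n : ℂ) + 1)))⁻¹ := by
    rw [← Finset.prod_inv_distrib]
    refine Finset.prod_congr rfl fun n hn => ?_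
    rw [if_neg (by omega)]
    have h0 : (n : ℂ) + 1 ≠ 0 := by exact_mod_cast Nat.succ_ne_zero n
    have h1 : ((l + 1 + n : ℕ) : ℂ) + 1 ≠ 0 := by exact_mod_cast Nat.succ_ne_zero (l + 1 + n)
    have h2 : (1 - -((l + 1 : ℕ) : ℂ) / ((n : ℂ) + 1)) =
      (((l + 1 + n : ℕ) : ℂ) + 1) / ((n : ℂ) + 1) := by
      field_simp; push_cast; ring
    rw [h2, inv_div]
    field_simp
    push_cast
    ring
  rw [e1, e2, cpow_neg, cpow_natCast, cpow_natCast, Nat.add_sub_cancel, mul_inv, inv_inv]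
  have e3 : (((l + 1 + M : ℕ)) : ℂ) = M * (1 + ((l + 1 : ℕ) : ℂ) / M) := by
    field_simp; push_cast; ring
  rw [e3, mul_pow]
  ring

/-- Theorem 2.1 of the paper: if `r₁ = k` is a positive integer and no other root
`r₂,…,r_p, s₁,…,s_q` is a positive integer, with `∑ rᵢ = ∑ sⱼ`, then
`∏_{n≥1, n≠k} (∏ᵢ (1 - rᵢ/n)) / (∏ⱼ (1 - sⱼ/n))
  = (-1)^{k-1} k^{p-q} (k-1)! ∏ⱼ (k - sⱼ)Γ(1 - sⱼ) / ∏_{i≥2} (k - rᵢ)Γ(1 - rᵢ)`. -/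
theorem infinite_prod_ratio_polynomials_integer_root (p q k : ℕ) (hp : 0 < p) (hk : 0 < k)
    (r : Fin p → ℂ) (s : Fin q → ℂ)
    (hr0 : ∀ i, r i ≠ 0) (hs0 : ∀ j, s j ≠ 0)
    (hrk : r ⟨0, hp⟩ = (k : ℂ))
    (hrn : ∀ i, i ≠ (⟨0, hp⟩ : Fin p) → ∀ n : ℕ, 0 < n → r i ≠ (n : ℂ))
    (hsn : ∀ j, ∀ n : ℕ, 0 < n → s j ≠ (n : ℂ))
    (hsum : ∑ i, r i = ∑ j, s j) :
    Multipliable (fun n : {n : ℕ+ // (n : ℕ) ≠ k} =>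
      (∏ i, (1 - r i / ((n : ℕ+) : ℂ))) / (∏ j, (1 - s j / ((n : ℕ+) : ℂ)))) ∧
    ∏' n : {n : ℕ+ // (n : ℕ) ≠ k},
        (∏ i, (1 - r i / ((n : ℕ+) : ℂ))) / (∏ j, (1 - s j / ((n : ℕ+) : ℂ)))
      = (-1) ^ (k - 1) * (k : ℂ) ^ ((p : ℤ) - (q : ℤ)) * (Nat.factorial (k - 1) : ℂ) *
        (∏ j, ((k : ℂ) - s j) * Complex.Gamma (1 - s j)) /
        (∏ i ∈ Finset.univ.erase (⟨0, hp⟩ : Fin p),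
          ((k : ℂ) - r i) * Complex.Gamma (1 - r i)) := by
  classical
  set F : ℕ → ℂ := fun n => if n + 1 = k then 1 else
    (∏ i, (1 - r i / ((n : ℂ) + 1))) / (∏ j, (1 - s j / ((n : ℂ) + 1))) with hF
  have hkc : (k : ℂ) ≠ 0 := by exact_mod_cast hk.ne'
  -- multipliability
  have hmul : Multipliable F := by
    have hx : Filter.Tendsto (fun n : ℕ => (1 : ℂ) / ((n : ℂ) + 1)) Filter.atTop (nhds 0) :=
      tendsto_one_div_add_atTop_nhds_zero_nat
    have hO := (aux_quot_bigO r s hsum).comp_tendsto hx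
    have hsm : Summable (fun n : ℕ => ‖((1 : ℂ) / ((n : ℂ) + 1)) ^ 2‖) := by
      have h2 : Summable (fun n : ℕ => 1 / ((n : ℝ)) ^ 2) :=
        Real.summable_one_div_nat_pow.2 (by norm_num)
      have h3 := (summable_nat_add_iff 1).2 h2
      refine h3.congr fun n => ?_
      have : ‖(n : ℂ) + 1‖ = (n : ℝ) + 1 := by
        have := Complex.norm_natCast (n + 1)
        push_cast at this
        exact this
      simp [this]
    have hsum1 : Summable (fun n => ‖F n - 1‖) := by
      refine summable_of_isBigO_nat hsm (Asymptotics.IsBigO.norm_norm ?_)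
      refine hO.congr' ?_ Filter.EventuallyEq.rfl
      filter_upwards [Filter.eventually_ge_atTop k] with n hn
      simp only [hF, Function.comp]
      rw [if_neg (by omega)]
      simp only [mul_one_div]
    have := multipliable_one_add_of_summable hsum1
    simpa using this
  -- the limit
  have hlim : Filter.Tendsto (fun N : ℕ => ∏ n ∈ Finset.range N, F n) Filter.atTop
      (nhds ((-1) ^ (k - 1) * (k : ℂ) ^ ((p : ℤ) - (q : ℤ)) * (Nat.factorial (k - 1) : ℂ) *
        (∏ j, ((k : ℂ) - s j) * Complex.Gamma (1 - s j)) /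
        (∏ i ∈ Finset.univ.erase (⟨0, hp⟩ : Fin p),
          ((k : ℂ) - r i) * Complex.Gamma (1 - r i)))) := by
    let g : ℂ → ℕ → ℂ := fun z N => (∏ n ∈ Finset.range N,
      (if n + 1 = k then 1 else (1 - z / ((n : ℂ) + 1)))) * (N : ℂ) ^ z
    have hne : ∀ j, (k : ℂ) * ((k - s j) * Gamma (1 - s j))⁻¹ ≠ 0 := by
      intro j
      refine mul_ne_zero hkc (inv_ne_zero (mul_ne_zero (sub_ne_zero.2 (hsn j k hk).symm) ?_))
      refine Gamma_ne_zero fun m hm => hsn j (m + 1) m.succ_pos ?_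
      push_cast
      linear_combination -hm
    have hS : Filter.Tendsto (fun N => ∏ j, g (s j) N) Filter.atTop
        (nhds (∏ j, (k : ℂ) * ((k - s j) * Gamma (1 - s j))⁻¹)) :=
      tendsto_finsetProd _ fun j _ => aux_lim1 k hk (s j) (hs0 j) (hsn j)
    have hR' : Filter.Tendsto (fun N => ∏ i ∈ Finset.univ.erase (⟨0, hp⟩ : Fin p), g (r i) N)
        Filter.atTop (nhds (∏ i ∈ Finset.univ.erase (⟨0, hp⟩ : Fin p),
          (k : ℂ) * ((k - r i) * Gamma (1 - r i))⁻¹)) :=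
      tendsto_finsetProd _ fun i hi =>
        aux_lim1 k hk (r i) (hr0 i) (hrn i (Finset.mem_erase.1 hi).1)
    have hR := (aux_lim2 k hk).mul hR'
    have hq := hR.div hS (Finset.prod_ne_zero_iff.2 fun j _ => hne j)
    have hval : ((-1) ^ (k - 1) * (Nat.factorial k : ℂ) *
        ∏ i ∈ Finset.univ.erase (⟨0, hp⟩ : Fin p), (k : ℂ) * ((k - r i) * Gamma (1 - r i))⁻¹) /
        (∏ j, (k : ℂ) * ((k - s j) * Gamma (1 - s j))⁻¹) =
        ((-1) ^ (k - 1) * (k : ℂ) ^ ((p : ℤ) - (q : ℤ)) * (Nat.factorial (k - 1) : ℂ) *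
        (∏ j, ((k : ℂ) - s j) * Complex.Gamma (1 - s j)) /
        (∏ i ∈ Finset.univ.erase (⟨0, hp⟩ : Fin p),
          ((k : ℂ) - r i) * Complex.Gamma (1 - r i))) := by
      rw [Finset.prod_mul_distrib, Finset.prod_mul_distrib (f := fun _ => (k : ℂ)),
        Finset.prod_inv_distrib, Finset.prod_inv_distrib, Finset.prod_const, Finset.prod_const,
        Finset.card_erase_of_mem (Finset.mem_univ _), Finset.card_univ, Fintype.card_fin,
        Finset.card_univ, Fintype.card_fin, zpow_sub₀ hkc, zpow_natCast, zpow_natCast,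
        ← Nat.mul_factorial_pred hk.ne']
      have hpp : (k : ℂ) ^ p = k ^ (p - 1) * k := by
        rw [← pow_succ, Nat.sub_add_cancel hp]
      rw [hpp, div_eq_mul_inv, div_eq_mul_inv, div_eq_mul_inv, mul_inv, inv_inv]
      push_cast
      ring
    rw [hval] at hq
    refine hq.congr' ?_
    filter_upwards [Filter.eventually_gt_atTop 0] with N hN
    have hNc : (N : ℂ) ≠ 0 := by exact_mod_cast hN.ne'
    have e0 : (∏ n ∈ Finset.range N, (if n + 1 = k then 1 else (1 - (k : ℂ) / ((n : ℂ) + 1))))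
        * (N : ℂ) ^ (k : ℂ) = g (r ⟨0, hp⟩) N := by simp only [g, hrk]
    have hprod : ∀ (m : ℕ) (t : Fin m → ℂ), ∏ i, g (t i) N =
        (∏ n ∈ Finset.range N, if n + 1 = k then 1 else ∏ i, (1 - t i / ((n : ℂ) + 1)))
          * (N : ℂ) ^ (∑ i, t i) := by
      intro m t
      simp only [g]
      rw [Finset.prod_mul_distrib, Finset.prod_comm]
      congr 1
      · refine Finset.prod_congr rfl fun n _ => ?_
        split_ifs <;> simp
      · exact aux_cpow_sum _ _ _ hNc
    simp only [Pi.div_apply]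
    rw [e0, Finset.mul_prod_erase _ (fun i => g (r i) N) (Finset.mem_univ _), hprod, hprod, hsum,
      mul_div_mul_right _ _ (by simp [cpow_eq_zero_iff, hNc]), ← Finset.prod_div_distrib]
    refine Finset.prod_congr rfl fun n _ => ?_
    simp only [hF]
    split_ifs <;> simp
  have hP := hmul.hasProd
  have hval := tendsto_nhds_unique hP.tendsto_prod_nat hlim
  rw [hval] at hP
  let e : {n : ℕ+ // (n : ℕ) ≠ k} → ℕ := fun n => n.1.natPred
  have he : Function.Injective e := by
    intro a b hab
    exact Subtype.ext (PNat.natPred_injective hab)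
  have hoff : ∀ x ∉ Set.range e, F x = 1 := by
    intro x hx
    by_contra hne
    apply hx
    have hxk : x + 1 ≠ k := fun h => hne (by simp [hF, h])
    exact ⟨⟨x.succPNat, by simpa using hxk⟩, by simp [e]⟩
  have hfin := (he.hasProd_iff hoff).2 hP
  have hcomp : F ∘ e = (fun n : {n : ℕ+ // (n : ℕ) ≠ k} =>
      (∏ i, (1 - r i / ((n : ℕ+) : ℂ))) / (∏ j, (1 - s j / ((n : ℕ+) : ℂ)))) := by
    funext n
    have h1 : n.1.natPred + 1 = (n.1 : ℕ) := PNat.natPred_add_one _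
    have h2 : ((n.1.natPred : ℂ)) + 1 = ((n.1 : ℕ) : ℂ) := by exact_mod_cast h1
    simp only [Function.comp, e, hF]
    rw [if_neg (by rw [h1]; exact n.2), h2]
  rw [hcomp] at hfin
  exact ⟨hfin.multipliable, hfin.tprod_eq⟩
end

section
/- For every positive integer k, the infinite product over all positive integers n ≠ k of (1 − k²/n²) converges and ∏_{n=1, n≠k}^∞ (1 − k²/n²) = (−1)^{k−1}/2. -/
open Filter Topology in
theorem aux_ratio (k : ℕ) : Tendsto (fun M : ℕ =>
    ((M.factorial : ℝ) * ((2 * k + M).factorial : ℝ)) / ((k + M).factorial : ℝ) ^ 2) atTop (𝓝 1) := by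
  have h : ∀ M : ℕ, ((M.factorial : ℝ) * ((2 * k + M).factorial : ℝ)) / ((k + M).factorial : ℝ) ^ 2
      = ∏ i ∈ Finset.range k, (1 + (k : ℝ) / ((M : ℝ) + i + 1)) := by
    intro M
    have h1 : ∀ a b : ℕ, ((a + b).factorial : ℝ) = a.factorial * ∏ i ∈ Finset.range b, ((a : ℝ) + i + 1) := by
      intro a b
      induction b with
      | zero => simp
      | succ b ih =>
        rw [Finset.prod_range_succ, ← mul_assoc, ← ih, ← add_assoc, Nat.factorial_succ]
        push_cast; ring
    have e1 : 2 * k + M = (k + M) + k := by ring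
    have e2 := h1 M k
    rw [e1, h1 (k + M) k]
    have hP : ∏ i ∈ Finset.range k, (1 + (k : ℝ) / ((M : ℝ) + i + 1)) =
      (∏ i ∈ Finset.range k, (((k + M : ℕ) : ℝ) + i + 1)) / ∏ i ∈ Finset.range k, ((M : ℝ) + i + 1) := by
      rw [← Finset.prod_div_distrib]
      refine Finset.prod_congr rfl fun i _ => ?_
      have : (M : ℝ) + i + 1 ≠ 0 := by positivity
      field_simp
      push_cast; ring
    rw [hP]
    have p1 : ∏ i ∈ Finset.range k, ((M : ℝ) + i + 1) ≠ 0 :=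
      Finset.prod_ne_zero_iff.2 fun i _ => by positivity
    have p2 : ((k + M).factorial : ℝ) ≠ 0 := by positivity
    rw [div_eq_div_iff (by positivity) p1, add_comm k M] at *
    rw [pow_two]
    nth_rewrite 3 [e2]
    ring
  simp_rw [h]
  have key : Tendsto (fun M : ℕ => ∏ i ∈ Finset.range k, (1 + (k : ℝ) / ((M : ℝ) + i + 1))) atTop
      (𝓝 (∏ i ∈ Finset.range k, (1 + 0 : ℝ))) := by
    refine tendsto_finsetProd _ fun i _ => ?_
    refine Tendsto.add tendsto_const_nhds (Tendsto.div_atTop tendsto_const_nhds ?_)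
    simp_rw [add_assoc]
    exact tendsto_atTop_add_const_right _ _ tendsto_natCast_atTop_atTop
  simpa using key

theorem aux_low (k : ℕ) (j r : ℕ) (h : j + r + 1 = k) :
    ∏ m ∈ Finset.range j, (1 - (k : ℝ) ^ 2 / ((m : ℝ) + 1) ^ 2) =
      (-1) ^ j * ((k + j).factorial : ℝ) / ((r.factorial : ℝ) * k * (j.factorial : ℝ) ^ 2) := by
  induction j generalizing r with
  | zero =>
    subst h
    have : (0 + r + 1 + 0).factorial = (r + 1) * r.factorial := by
      rw [← Nat.factorial_succ]; congr 1; omega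
    rw [this]
    have : (r.factorial : ℝ) ≠ 0 := by positivity
    push_cast
    simp
    field_simp
  | succ j ih =>
    rw [Finset.prod_range_succ, ih (r + 1) (by omega), ← add_assoc, Nat.factorial_succ (k + j),
      Nat.factorial_succ r, Nat.factorial_succ j]
    have hk : (k : ℝ) = j + r + 2 := by rw [← h]; push_cast; ring
    have h1 : (r.factorial : ℝ) ≠ 0 := by positivity
    have h2 : (j.factorial : ℝ) ≠ 0 := by positivity
    have h3 : (k : ℝ) ≠ 0 := by rw [hk]; positivity
    have h4 : (r : ℝ) + 1 ≠ 0 := by positivity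
    have h5 : (j : ℝ) + 1 ≠ 0 := by positivity
    push_cast
    field_simp
    rw [hk]
    ring

noncomputable def auxg (k : ℕ) (m : ℕ) : ℝ :=
  if m + 1 = k then 1 else 1 - (k : ℝ) ^ 2 / ((m : ℝ) + 1) ^ 2

theorem aux_closed (k : ℕ) (hk : 0 < k) (M : ℕ) :
    ∏ m ∈ Finset.range (M + k), auxg k m = (-1) ^ (k - 1) / 2 *
      (((M.factorial : ℝ) * ((2 * k + M).factorial : ℝ)) / ((k + M).factorial : ℝ) ^ 2) := by
  induction M with
  | zero =>
    obtain ⟨j, rfl⟩ : ∃ j, k = j + 1 := ⟨k - 1, by omega⟩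
    rw [zero_add, Finset.prod_range_succ]
    have : ∏ m ∈ Finset.range j, auxg (j + 1) m =
        ∏ m ∈ Finset.range j, (1 - ((j + 1 : ℕ) : ℝ) ^ 2 / ((m : ℝ) + 1) ^ 2) := by
      refine Finset.prod_congr rfl fun m hm => ?_
      rw [Finset.mem_range] at hm
      rw [auxg, if_neg (by omega)]
    rw [this, aux_low (j + 1) j 0 (by omega)]
    have e : 2 * (j + 1) + 0 = (j + 1 + j) + 1 := by ring
    rw [e, Nat.factorial_succ (j + 1 + j), add_zero, Nat.factorial_succ j]
    have h2 : (j.factorial : ℝ) ≠ 0 := by positivity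
    have h5 : (j : ℝ) + 1 ≠ 0 := by positivity
    simp [auxg]
    field_simp
    ring
  | succ M ih =>
    rw [show M + 1 + k = (M + k) + 1 by ring, Finset.prod_range_succ, ih, ← add_assoc, ← add_assoc,
      Nat.factorial_succ M, Nat.factorial_succ (2 * k + M), Nat.factorial_succ (k + M), auxg,
      if_neg (by omega)]
    have h1 : ((k + M).factorial : ℝ) ≠ 0 := by positivity
    have h2 : (k : ℝ) + M + 1 ≠ 0 := by positivity
    have h3 : (M : ℝ) + k + 1 ≠ 0 := by positivity
    push_cast
    rw [add_comm (M : ℝ) k]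
    field_simp
    ring

/-- Equation (2.4): for every positive integer `k`,
`∏_{n=1, n≠k}^∞ (1 - k²/n²) = (-1)^{k-1}/2`. -/
theorem prod_one_sub_sq_ratio (k : ℕ) (hk : 0 < k) :
    Multipliable (fun n : {n : ℕ+ // (n : ℕ) ≠ k} =>
      (1 - (k : ℝ) ^ 2 / ((n : ℕ+) : ℝ) ^ 2)) ∧
    ∏' n : {n : ℕ+ // (n : ℕ) ≠ k}, (1 - (k : ℝ) ^ 2 / ((n : ℕ+) : ℝ) ^ 2)
      = (-1) ^ (k - 1) / 2 := by
  have hm : Multipliable (fun n : {n : ℕ+ // (n : ℕ) ≠ k} =>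
      (1 - (k : ℝ) ^ 2 / ((n : ℕ+) : ℝ) ^ 2)) := by
    have hs : Summable (fun n : ℕ => -((k : ℝ) ^ 2 / (n : ℝ) ^ 2)) := by
      have := ((Real.summable_one_div_nat_pow (p := 2)).2 (by norm_num)).mul_left (-(k : ℝ) ^ 2)
      refine this.congr fun n => ?_
      ring
    have hi : Function.Injective (fun n : {n : ℕ+ // (n : ℕ) ≠ k} => ((n : ℕ+) : ℕ)) :=
      PNat.coe_injective.comp Subtype.val_injective
    have := Real.multipliable_one_add_of_summable (hs.comp_injective hi)
    simpa [Function.comp_def, sub_eq_add_neg] using this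
  refine ⟨hm, ?_⟩
  have h1 := hm.hasProd
  have h2 := (hasProd_subtype_iff_mulIndicator (s := {n : ℕ+ | (n : ℕ) ≠ k})
    (f := fun n : ℕ+ => (1 - (k : ℝ) ^ 2 / (n : ℝ) ^ 2))).1 h1
  have h3 := (Equiv.pnatEquivNat.symm.hasProd_iff).2 h2
  have h4 : HasProd (auxg k) (∏' n : {n : ℕ+ // (n : ℕ) ≠ k}, (1 - (k : ℝ) ^ 2 / ((n : ℕ+) : ℝ) ^ 2)) := by
    convert h3 using 1
    funext m
    by_cases h : m + 1 = k <;> simp [auxg, Set.mulIndicator, h]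
  have h5 := h4.tendsto_prod_nat.comp (Filter.tendsto_add_atTop_nat k)
  have h6 := (aux_ratio k).const_mul ((-1 : ℝ) ^ (k - 1) / 2)
  rw [mul_one] at h6
  refine tendsto_nhds_unique h5 (h6.congr fun M => ?_)
  exact (aux_closed k hk M).symm
end

section
/- Let a and b be nonzero complex numbers such that n²a² ≠ b² for every integer n ≥ 0 (equivalently, na ≠ ±b for all n ≥ 0), and such that sin(πb/a) ≠ 0. Then the series ∑_{n=0}^∞ (−1)^n/(n²a² − b²) converges absolutely and equals −1/(2b²) − π/(2ab·sin(πb/a)). -/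
open Complex Real

lemma HasSum.congr_val {f : ℕ → ℂ} {u v : ℂ} (h : HasSum f u) (e : u = v) : HasSum f v :=
  e ▸ h

lemma aux_hasSum (x : ℂ) (hx : x ∈ Complex.integerComplement) :
    HasSum (fun n : ℕ => 1 / ((n : ℂ) ^ 2 - x ^ 2))
      (-1 / (2 * x ^ 2) - (Real.pi : ℂ) * Complex.cot (Real.pi * x) / (2 * x)) := by
  have hx0 : x ≠ 0 := Complex.integerComplement.ne_zero hx
  have h1 := (summable_cotTerm hx).hasSum
  have h2 := cot_series_rep' hx
  have h3 : HasSum (fun n : ℕ => 1 / (((n + 1 : ℕ) : ℂ) ^ 2 - x ^ 2))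
      ((-1 / (2 * x)) * (Real.pi * Complex.cot (Real.pi * x) - 1 / x)) := by
    rw [h2]
    refine (h1.mul_left (-1 / (2 * x))).congr_fun ?_
    intro n
    have e1 : x - (n + 1) ≠ 0 := by
      have := Complex.integerComplement_add_ne_zero hx (-(n + 1 : ℤ))
      intro h; apply this; push_cast; linear_combination h
    have e2 : x + (n + 1) ≠ 0 := by
      have := Complex.integerComplement_add_ne_zero hx ((n + 1 : ℤ))
      intro h; apply this; push_cast; linear_combination h
    have e3 : ((n + 1 : ℕ) : ℂ) ^ 2 - x ^ 2 ≠ 0 := by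
      have := mul_ne_zero e1 e2
      intro h; apply this; push_cast at h; linear_combination -h
    simp only [cotTerm]
    push_cast at e3 ⊢
    field_simp
    ring
  have h4 := (hasSum_nat_add_iff (f := fun n : ℕ => 1 / ((n : ℂ) ^ 2 - x ^ 2)) 1).1 h3
  refine h4.congr_val ?_
  rw [Finset.sum_range_one]
  push_cast
  have e0 : (0 : ℂ) ^ 2 - x ^ 2 = - x ^ 2 := by ring
  rw [e0]
  field_simp
  ring

/-- `∑_{n=0}^∞ (-1)^n/(n²a² - b²) = -1/(2b²) - π/(2ab·sin(πb/a))`, for nonzero complex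
`a, b` with `n²a² ≠ b²` for all `n ≥ 0` and `sin(πb/a) ≠ 0`. -/
theorem sum_alternating_inv_n_sq_a_sq_sub_b_sq (a b : ℂ) (ha : a ≠ 0) (hb : b ≠ 0)
    (hab : ∀ n : ℕ, (n : ℂ) ^ 2 * a ^ 2 ≠ b ^ 2)
    (hs : Complex.sin ((Real.pi : ℂ) * b / a) ≠ 0) :
    Summable (fun n : ℕ => (-1) ^ n / ((n : ℂ) ^ 2 * a ^ 2 - b ^ 2)) ∧
    ∑' n : ℕ, (-1) ^ n / ((n : ℂ) ^ 2 * a ^ 2 - b ^ 2)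
      = -1 / (2 * b ^ 2) - (Real.pi : ℂ) / (2 * a * b * Complex.sin ((Real.pi : ℂ) * b / a)) := by
  obtain ⟨x, rfl⟩ : ∃ x, b = a * x := ⟨b / a, by field_simp⟩
  have hx0 : x ≠ 0 := right_ne_zero_of_mul hb
  have hpx : (Real.pi : ℂ) * (a * x) / a = Real.pi * x := by field_simp
  rw [hpx] at hs ⊢
  have hx : x ∈ Complex.integerComplement := by
    rintro ⟨k, rfl⟩
    apply hs
    rw [mul_comm]
    exact Complex.sin_int_mul_pi k
  have hx2 : x / 2 ∈ Complex.integerComplement := by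
    rintro ⟨k, hk⟩
    apply hx
    exact ⟨2 * k, by push_cast; rw [hk]; ring⟩
  have h1 := aux_hasSum x hx
  have h2 := (aux_hasSum (x / 2) hx2).mul_left (1 / 4)
  have inj : Function.Injective (fun m : ℕ => 2 * m) := fun p q h => by
    simpa using h
  have h3 : HasSum (fun n : ℕ => if Even n then 1 / ((n : ℂ) ^ 2 - x ^ 2) else 0)
      (1 / 4 * (-1 / (2 * (x / 2) ^ 2)
        - (Real.pi : ℂ) * Complex.cot (Real.pi * (x / 2)) / (2 * (x / 2)))) := by
    rw [← inj.hasSum_iff]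
    · refine h2.congr_fun ?_
      intro m
      simp only [Function.comp, even_two_mul, if_true]
      rw [← mul_div_mul_comm]
      push_cast
      congr 1 <;> ring
    · intro n hn
      rw [if_neg]
      rintro ⟨m, rfl⟩
      exact hn ⟨m, by simp; ring⟩
  have h4 := (((h3.mul_left 2).sub h1).mul_left (1 / a ^ 2))
  have h5 : HasSum (fun n : ℕ => (-1) ^ n / ((n : ℂ) ^ 2 * a ^ 2 - (a * x) ^ 2))
      (-1 / (2 * (a * x) ^ 2)
        - (Real.pi : ℂ) / (2 * a * (a * x) * Complex.sin ((Real.pi : ℂ) * x))) := by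
    refine (h4.congr_fun ?_).congr_val ?_
    · intro n
      have : (n : ℂ) ^ 2 * a ^ 2 - (a * x) ^ 2 = a ^ 2 * ((n : ℂ) ^ 2 - x ^ 2) := by ring
      rw [this]
      rcases Nat.even_or_odd n with h | h
      · rw [h.neg_one_pow, if_pos h, ← one_div_mul_one_div]; ring
      · rw [h.neg_one_pow, if_neg (Nat.not_even_iff_odd.2 h), neg_div, ← one_div_mul_one_div]; ring
    · have e : (Real.pi : ℂ) * x = 2 * (Real.pi * (x / 2)) := by ring
      rw [e] at hs ⊢
      generalize (Real.pi : ℂ) * (x / 2) = y at *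
      rw [Complex.cot, Complex.cot, Complex.cos_two_mul]
      rw [Complex.sin_two_mul] at hs ⊢
      have hsy : Complex.sin y ≠ 0 := fun h => hs (by simp [h])
      have hcy : Complex.cos y ≠ 0 := fun h => hs (by simp [h])
      field_simp
      ring
  exact ⟨h5.summable, h5.tsum_eq⟩
end

section
/- The series ∑_{n=2}^∞ [1/(√n − 1)³ − 1/(√n + 1)³] converges and its sum equals π² + 8·ζ(3), where ζ(3) = ∑_{m=1}^∞ 1/m³. -/
open Real

lemma aux_term (m : ℕ) :
    1 / (Real.sqrt ((m + 2 : ℕ) : ℝ) - 1) ^ 3 - 1 / (Real.sqrt ((m + 2 : ℕ) : ℝ) + 1) ^ 3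
      = 6 * (1 / ((m : ℝ) + 1) ^ 2) + 8 * (1 / ((m : ℝ) + 1) ^ 3) := by
  set s := Real.sqrt ((m + 2 : ℕ) : ℝ) with hs
  have h2 : s ^ 2 = (m : ℝ) + 2 := by
    rw [hs, Real.sq_sqrt (by positivity)]; push_cast; ring
  have h0 : 0 ≤ s := Real.sqrt_nonneg _
  have hm : (0 : ℝ) ≤ m := Nat.cast_nonneg m
  have h1 : s - 1 ≠ 0 := by
    intro h
    have : s = 1 := by linarith
    rw [this] at h2; linarith
  have h3 : s + 1 ≠ 0 := by positivity
  have h4 : (m : ℝ) + 1 = (s - 1) * (s + 1) := by linarith [h2, sq s, mul_comm s s]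
  rw [h4]
  field_simp
  ring

/-- Equation (2.7): `∑_{n=2}^∞ (1/(√n - 1)³ - 1/(√n + 1)³) = π² + 8ζ(3)`. -/
theorem sum_inv_cube_sqrt_sub_one (ζ3 : ℝ) (hζ3 : ζ3 = ∑' m : ℕ, 1 / ((m : ℝ) + 1) ^ 3) :
    Summable (fun n : {n : ℕ // 2 ≤ n} =>
      1 / (Real.sqrt (n : ℕ) - 1) ^ 3 - 1 / (Real.sqrt (n : ℕ) + 1) ^ 3) ∧
    ∑' n : {n : ℕ // 2 ≤ n}, (1 / (Real.sqrt (n : ℕ) - 1) ^ 3 - 1 / (Real.sqrt (n : ℕ) + 1) ^ 3)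
      = Real.pi ^ 2 + 8 * ζ3 := by
  have hS3 : HasSum (fun m : ℕ => 1 / ((m : ℝ) + 1) ^ 3) ζ3 := by
    rw [hζ3]
    apply Summable.hasSum
    have := (summable_nat_add_iff 1).2 (Real.summable_one_div_nat_pow.2 (by norm_num : 1 < 3))
    simpa using this
  have hS2 : HasSum (fun m : ℕ => 1 / ((m : ℝ) + 1) ^ 2) (Real.pi ^ 2 / 6) := by
    have := (hasSum_nat_add_iff' 1).2 hasSum_zeta_two
    simpa using this
  have hS := (hS2.mul_left 6).add (hS3.mul_left 8)
  let e : ℕ ≃ {n : ℕ // 2 ≤ n} :=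
    { toFun := fun m => ⟨m + 2, by omega⟩
      invFun := fun n => n.1 - 2
      left_inv := fun m => by simp
      right_inv := fun n => by
        apply Subtype.ext
        have := n.2
        change n.1 - 2 + 2 = n.1
        omega }
  have key : HasSum (fun n : {n : ℕ // 2 ≤ n} =>
      1 / (Real.sqrt (n : ℕ) - 1) ^ 3 - 1 / (Real.sqrt (n : ℕ) + 1) ^ 3)
      (Real.pi ^ 2 + 8 * ζ3) := by
    rw [← e.hasSum_iff]
    have h6 : Real.pi ^ 2 + 8 * ζ3 = 6 * (Real.pi ^ 2 / 6) + 8 * ζ3 := by ring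
    rw [h6]
    rw [← funext aux_term] at hS
    exact hS
  exact ⟨key.summable, key.tsum_eq⟩
end

section
/- Let a be a positive real number such that sin(a^{3/2}) ≠ 0. Let ω = e^{2πi/3}. Then the series ∑_{n=1}^∞ [1/((πn)^{2/3} − a)² + 1/((πn)^{2/3}·ω − a)² + 1/((πn)^{2/3}·ω̄ − a)²] converges and equals −(3/(4√a))·cot(a^{3/2}) + (9/4)·a/sin²(a^{3/2}) − 3/(2a²). -/
open Real Complex

lemma aux_terms (r a ω v : ℂ) (h : ω ^ 2 + ω + 1 = 0) (hv : v = -1 - ω) (h0 : a ^ 3 - r ^ 3 ≠ 0) :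
    1 / (r - a) ^ 2 + 1 / (r * ω - a) ^ 2 + 1 / (r * v - a) ^ 2
      = (3 * a ^ 4 + 6 * a * r ^ 3) / (a ^ 3 - r ^ 3) ^ 2 := by
  subst hv
  have h3 : (r - a) * (r * ω - a) * (r * (-1 - ω) - a) = -(a ^ 3 - r ^ 3) := by
    grind
  have h4 : (r - a) * (r * ω - a) * (r * (-1 - ω) - a) ≠ 0 := by
    rw [h3]; exact neg_ne_zero.mpr h0
  have hp : r - a ≠ 0 := by
    intro hh; apply h4; rw [hh]; ring
  have hq : r * ω - a ≠ 0 := by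
    intro hh; apply h4; rw [hh]; ring
  have hs : r * (-1 - ω) - a ≠ 0 := by
    intro hh; apply h4; rw [hh]; ring
  have e1 : (r * ω - a) * (r * (-1 - ω) - a) = r ^ 2 + r * a + a ^ 2 := by
    grind
  have e2 : (r - a) * (r * (-1 - ω) - a) = r ^ 2 * (-1 - ω) + r * a * ω + a ^ 2 := by
    grind
  have e3 : (r - a) * (r * ω - a) = r ^ 2 * ω - r * a * (1 + ω) + a ^ 2 := by
    grind
  have hsq : (a ^ 3 - r ^ 3) ^ 2 = ((r - a) * (r * ω - a) * (r * (-1 - ω) - a)) ^ 2 := by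
    rw [h3]; ring
  have key : ((r * ω - a) * (r * (-1 - ω) - a)) ^ 2 + ((r - a) * (r * (-1 - ω) - a)) ^ 2
      + ((r - a) * (r * ω - a)) ^ 2 = 3 * a ^ 4 + 6 * a * r ^ 3 := by
    rw [e1, e2, e3]
    grind
  rw [hsq, ← key]
  field_simp

lemma aux_csc (x : ℂ) (hx : x ∈ Complex.integerComplement) :
    HasSum (fun n : ℕ => 1 / (x - (n + 1)) ^ 2 + 1 / (x + (n + 1)) ^ 2)
      (π ^ 2 / Complex.sin (π * x) ^ 2 - 1 / x ^ 2) := by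
  have hop : IsOpen (Complex.integerComplement) := Complex.isOpen_compl_range_intCast
  obtain ⟨r, hr, hball⟩ := Metric.isOpen_iff.mp hop x hx
  have hfar : ∀ n : ℤ, r ≤ ‖x + n‖ := by
    intro n
    by_contra! hlt
    have : ((-n : ℤ) : ℂ) ∈ Complex.integerComplement := hball (by
      rw [Metric.mem_ball, dist_comm, dist_eq_norm]; simpa using hlt)
    exact this ⟨-n, rfl⟩
  have hlow : ∀ (n : ℤ) y, y ∈ Metric.ball x (r / 2) → ‖x + n‖ / 2 ≤ ‖y + n‖ := by
    intro n y hy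
    rw [Metric.mem_ball, dist_comm, dist_eq_norm] at hy
    have h1 : ‖x + n‖ ≤ ‖x - y‖ + ‖y + n‖ := by
      calc ‖x + n‖ = ‖(x - y) + (y + n)‖ := by ring_nf
        _ ≤ _ := norm_add_le _ _
    linarith [hfar n]
  have hb : ∀ (n : ℤ) y, y ∈ Metric.ball x (r / 2) →
      ‖1 / (y + n) ^ 2‖ ≤ 4 * ‖((x + n) ^ 2)⁻¹‖ := by
    intro n y hy
    have h1 := hlow n y hy
    have h2 : 0 < ‖x + n‖ := hr.trans_le (hfar n)
    have h3 : 0 < ‖y + n‖ := by linarith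
    rw [norm_div, norm_inv, norm_pow, norm_pow, norm_one, ← div_eq_mul_inv,
      div_le_div_iff₀ (by positivity) (by positivity)]
    nlinarith
  have hS : Summable (fun n : ℤ => 4 * ‖((x + n) ^ 2)⁻¹‖) := by
    have := EisensteinSeries.linear_right_summable x 1 (k := 2) (by norm_num)
    refine (Summable.mul_left 4 (this.norm)).congr fun n => ?_
    simp
  have hS1 : Summable (fun n : ℕ => 4 * ‖((x + ((n + 1 : ℤ))) ^ 2)⁻¹‖) := by
    exact_mod_cast hS.comp_injective (i := fun n : ℕ => (n : ℤ) + 1) (fun a b h => by simpa using h)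
  have hS2 : Summable (fun n : ℕ => 4 * ‖((x + ((-(n + 1) : ℤ))) ^ 2)⁻¹‖) := by
    exact_mod_cast hS.comp_injective (i := fun n : ℕ => -((n : ℤ) + 1))
      (fun a b h => by simpa using h)
  have hxb : x ∈ Metric.ball x (r / 2) := Metric.mem_ball_self (by positivity)
  have hg' : ∀ (n : ℕ) y, y ∈ Metric.ball x (r / 2) →
      ‖-(1 / (y - (n + 1)) ^ 2 + 1 / (y + (n + 1)) ^ 2)‖ ≤
        4 * ‖((x + ((-(n + 1) : ℤ))) ^ 2)⁻¹‖ + 4 * ‖((x + ((n + 1 : ℤ))) ^ 2)⁻¹‖ := by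
    intro n y hy
    rw [norm_neg]
    refine (norm_add_le _ _).trans (add_le_add ?_ ?_)
    · refine le_trans (le_of_eq ?_) (hb _ y hy)
      push_cast; ring_nf
    · refine le_trans (le_of_eq ?_) (hb _ y hy)
      push_cast; ring_nf
  have hsub : Metric.ball x (r / 2) ⊆ Complex.integerComplement :=
    (Metric.ball_subset_ball (by linarith)).trans hball
  have hne : ∀ (n : ℤ) y, y ∈ Complex.integerComplement → y + n ≠ 0 := fun n y hy =>
    Complex.integerComplement_add_ne_zero hy n
  have hg : ∀ (n : ℕ) y, y ∈ Metric.ball x (r / 2) →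
      HasDerivAt (fun z : ℂ => 1 / (z - (n + 1)) + 1 / (z + (n + 1)))
        (-(1 / (y - (n + 1)) ^ 2 + 1 / (y + (n + 1)) ^ 2)) y := by
    intro n y hy
    have h1 : y - (n + 1) ≠ 0 := by
      have := hne (-(n + 1)) y (hsub hy)
      push_cast at this
      rwa [← sub_eq_add_neg] at this
    have h2 : y + (n + 1) ≠ 0 := by
      have := hne (n + 1) y (hsub hy)
      exact_mod_cast this
    have d1 := ((hasDerivAt_id y).sub_const ((n : ℂ) + 1)).inv h1
    have d2 := ((hasDerivAt_id y).add_const ((n : ℂ) + 1)).inv h2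
    have d := d1.add d2
    convert! d using 1
    · ext z; simp
    · simp; ring
  have hD := hasDerivAt_tsum_of_isPreconnected (hS2.add hS1) Metric.isOpen_ball
    (convex_ball x (r / 2)).isPreconnected hg hg' hxb (summable_cotTerm hx) hxb
  have hx0 : x ≠ 0 := by simpa using hne 0 x hx
  have hsin : Complex.sin (π * x) ≠ 0 := sin_pi_mul_ne_zero hx
  have hD2 : HasDerivAt (fun z : ℂ => π * Complex.cot (π * z) - 1 / z)
      (-(π ^ 2 / Complex.sin (π * x) ^ 2 - 1 / x ^ 2)) x := by
    have hl : HasDerivAt (fun z : ℂ => π * z) (π : ℂ) x := by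
      simpa using (hasDerivAt_id x).const_mul (π : ℂ)
    have d := (((hl.ccos).div (hl.csin) hsin).const_mul (π : ℂ)).sub (hasDerivAt_inv hx0)
    convert! d using 1
    · ext z; simp [Complex.cot]
    · have := Complex.sin_sq_add_cos_sq (π * x)
      field_simp
      linear_combination (π ^ 2 * x ^ 2 : ℂ) * this
  have hE := hD2.unique (hD.congr_of_eventuallyEq (by
    filter_upwards [hop.mem_nhds hx] with z hz
    exact cot_series_rep' hz))
  have hsum : Summable (fun n : ℕ => -(1 / (x - (n + 1)) ^ 2 + 1 / (x + (n + 1)) ^ 2)) :=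
    Summable.of_norm_bounded (hS2.add hS1) (fun n => hg' n x hxb)
  have := (hE ▸ hsum.hasSum).neg
  simpa using this

/-- Equation (2.8): for `a > 0` with `sin(a^{3/2}) ≠ 0`, with `ω = e^{2πi/3}`,
`∑_{n=1}^∞ [1/((πn)^{2/3} - a)² + 1/((πn)^{2/3}ω - a)² + 1/((πn)^{2/3}ω̄ - a)²]
 = -(3/(4√a))cot(a^{3/2}) + (9/4)a/sin²(a^{3/2}) - 3/(2a²)`. -/
theorem sum_over_zeros_sin_z_three_halves (a : ℝ) (ha : 0 < a)
    (hs : Real.sin (a ^ ((3 : ℝ) / 2)) ≠ 0)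
    (ω : ℂ) (hω : ω = Complex.exp (2 * Real.pi * Complex.I / 3)) :
    Summable (fun n : ℕ+ =>
      1 / ((((Real.pi * (n : ℝ)) ^ ((2 : ℝ) / 3) : ℝ) : ℂ) - (a : ℂ)) ^ 2 +
      1 / ((((Real.pi * (n : ℝ)) ^ ((2 : ℝ) / 3) : ℝ) : ℂ) * ω - (a : ℂ)) ^ 2 +
      1 / ((((Real.pi * (n : ℝ)) ^ ((2 : ℝ) / 3) : ℝ) : ℂ) * (starRingEnd ℂ ω) - (a : ℂ)) ^ 2) ∧
    ∑' n : ℕ+,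
        (1 / ((((Real.pi * (n : ℝ)) ^ ((2 : ℝ) / 3) : ℝ) : ℂ) - (a : ℂ)) ^ 2 +
         1 / ((((Real.pi * (n : ℝ)) ^ ((2 : ℝ) / 3) : ℝ) : ℂ) * ω - (a : ℂ)) ^ 2 +
         1 / ((((Real.pi * (n : ℝ)) ^ ((2 : ℝ) / 3) : ℝ) : ℂ) * (starRingEnd ℂ ω) - (a : ℂ)) ^ 2)
      = ((-(3 / (4 * Real.sqrt a)) * (Real.cos (a ^ ((3 : ℝ) / 2)) / Real.sin (a ^ ((3 : ℝ) / 2)))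
          + (9 / 4) * a / Real.sin (a ^ ((3 : ℝ) / 2)) ^ 2
          - 3 / (2 * a ^ 2) : ℝ) : ℂ) := by
  set s := Real.sqrt a with hsdef
  have hs0 : 0 < s := Real.sqrt_pos.mpr ha
  have hsa : a = s ^ 2 := (Real.sq_sqrt ha.le).symm
  have hw : a ^ ((3 : ℝ) / 2) = s ^ 3 := by
    rw [hsdef, Real.sqrt_eq_rpow, ← Real.rpow_natCast, ← Real.rpow_mul ha.le]; norm_num
  rw [hw] at hs ⊢
  have hpi := Real.pi_pos
  have hωr : ω = -1 / 2 + (Real.sqrt 3 / 2 : ℝ) * I := by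
    rw [hω, show (2 * π * I / 3 : ℂ) = ((π - π / 3 : ℝ) : ℂ) * I by push_cast; ring,
      Complex.exp_mul_I, ← Complex.ofReal_cos, ← Complex.ofReal_sin, Real.cos_pi_sub,
      Real.sin_pi_sub, Real.cos_pi_div_three, Real.sin_pi_div_three]
    push_cast; ring
  have h3 : ((Real.sqrt 3 : ℝ) : ℂ) ^ 2 = 3 := by
    rw [← Complex.ofReal_pow, Real.sq_sqrt (by norm_num)]; norm_num
  have hω2 : ω ^ 2 + ω + 1 = 0 := by
    rw [hωr]; push_cast
    linear_combination (1 / 4 * I ^ 2) * h3 + 3 / 4 * Complex.I_sq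
  have hωc : starRingEnd ℂ ω = -1 - ω := by
    rw [hωr]; simp only [map_add, map_mul, Complex.conj_ofReal, Complex.conj_I, map_div₀, map_neg,
      map_one, map_ofNat]; ring
  set x : ℂ := ((s ^ 3 / π : ℝ) : ℂ) with hxdef
  have hpx : (π : ℂ) * x = ((s ^ 3 : ℝ) : ℂ) := by
    rw [hxdef, ← Complex.ofReal_mul]; congr 1; field_simp
  have hx : x ∈ Complex.integerComplement := by
    rintro ⟨n, hn⟩
    apply hs
    rw [← Complex.ofReal_inj, Complex.ofReal_sin, ← hpx, ← hn, mul_comm, Complex.sin_int_mul_pi]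
    simp
  have hx0 : x ≠ 0 := by
    simpa using Complex.integerComplement_add_ne_zero hx 0
  have hpiC : (π : ℂ) ≠ 0 := by exact_mod_cast hpi.ne'
  have hsC : (s : ℂ) ≠ 0 := by exact_mod_cast hs0.ne'
  have H1 := (summable_cotTerm hx).hasSum
  have H2 := aux_csc x hx
  have e1 : ∑' n, cotTerm x n = π * Complex.cot (π * x) - 1 / x := (cot_series_rep' hx).symm
  rw [e1] at H1
  have H := (H1.mul_left (-3 * a / (4 * π ^ 2 * x) : ℂ)).add (H2.mul_left (9 * a / (4 * π ^ 2) : ℂ))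
  have hs' : Complex.sin ((s ^ 3 : ℝ) : ℂ) ≠ 0 := by
    rw [← Complex.ofReal_sin]; exact_mod_cast hs
  have HS : HasSum (fun n : ℕ+ =>
      1 / ((((Real.pi * (n : ℝ)) ^ ((2 : ℝ) / 3) : ℝ) : ℂ) - (a : ℂ)) ^ 2 +
      1 / ((((Real.pi * (n : ℝ)) ^ ((2 : ℝ) / 3) : ℝ) : ℂ) * ω - (a : ℂ)) ^ 2 +
      1 / ((((Real.pi * (n : ℝ)) ^ ((2 : ℝ) / 3) : ℝ) : ℂ) * (starRingEnd ℂ ω) - (a : ℂ)) ^ 2)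
      ((-(3 / (4 * s)) * (Real.cos (s ^ 3) / Real.sin (s ^ 3))
          + (9 / 4) * a / Real.sin (s ^ 3) ^ 2
          - 3 / (2 * a ^ 2) : ℝ) : ℂ) := by
    rw [← Equiv.pnatEquivNat.symm.hasSum_iff]
    convert! H using 1
    · ext n
      have hm : (((Equiv.pnatEquivNat.symm n : ℕ+) : ℕ) : ℝ) = (n : ℝ) + 1 := by
        simp
      simp only [Function.comp, hm]
      set r : ℝ := (π * ((n : ℝ) + 1)) ^ ((2 : ℝ) / 3) with hr
      have hr3 : r ^ 3 = π ^ 2 * ((n : ℝ) + 1) ^ 2 := by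
        rw [hr, ← Real.rpow_natCast, ← Real.rpow_mul (by positivity), ← mul_pow,
          ← Real.rpow_natCast]
        norm_num
      have hr3C : (r : ℂ) ^ 3 = π ^ 2 * ((n : ℂ) + 1) ^ 2 := by exact_mod_cast hr3
      have ha3 : (a : ℂ) ^ 3 = π ^ 2 * x ^ 2 := by
        rw [← mul_pow, hpx, hsa]; push_cast; ring
      have n1 : x + ((n : ℂ) + 1) ≠ 0 := by
        exact_mod_cast Complex.integerComplement_add_ne_zero hx (n + 1)
      have n2 : x - ((n : ℂ) + 1) ≠ 0 := by
        have := Complex.integerComplement_add_ne_zero hx (-(n + 1))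
        push_cast at this
        rwa [← sub_eq_add_neg] at this
      have hdiff : (a : ℂ) ^ 3 - r ^ 3 = π ^ 2 * ((x + (n + 1)) * (x - (n + 1))) := by
        rw [ha3, hr3C]; ring
      have hd0 : (a : ℂ) ^ 3 - r ^ 3 ≠ 0 := by
        rw [hdiff]
        exact mul_ne_zero (pow_ne_zero _ hpiC) (mul_ne_zero n1 n2)
      rw [aux_terms r a ω _ hω2 hωc hd0, hdiff,
        show (3 * (a : ℂ) ^ 4 + 6 * a * r ^ 3) = 3 * a * (a ^ 3 + 2 * r ^ 3) by ring, ha3, hr3C]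
      simp only [cotTerm]
      field_simp
      ring
    · rw [hpx, Complex.cot]
      have hxe : x = s ^ 3 / π := by rw [hxdef]; push_cast; ring
      rw [hxe, hsa]
      push_cast at hs' ⊢
      field_simp
      ring
  exact ⟨HS.summable, HS.tsum_eq⟩
end

section
/- Let ψ = Γ'/Γ be the digamma function, and let (ρ_n)_{n≥0} be real numbers with ψ(ρ_n) = 0 for all n, ρ₀ > 0, and ρ_n ∈ (−n, −n+1) for every n ≥ 1 (so ρ_n is the unique zero of ψ in that interval and ρ₀ = 1.461632… is the unique positive zero). Then the series ∑_{n=0}^∞ 1/ρ_n² converges absolutely and ∑_{n=0}^∞ 1/ρ_n² = γ² + π²/2, where γ is the Euler–Mascheroni constant. -/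
open Real

/-- The digamma function `ψ = Γ'/Γ` on the reals. -/
noncomputable def digamma (x : ℝ) : ℝ := deriv Real.Gamma x / Real.Gamma x

open Filter Topology

noncomputable def dgE (N : ℕ) : Polynomial ℝ :=
  ∏ k ∈ Finset.range N, (1 + Polynomial.C (1 / ((k : ℝ) + 1)) * Polynomial.X)

noncomputable def dgS (N : ℕ) (x : ℝ) : ℝ := ∑ k ∈ Finset.range (N + 1), 1 / (x + k)

noncomputable def dgQ (L : ℝ) (N : ℕ) : Polynomial ℝ :=
  Polynomial.derivative (Polynomial.X * dgE N) - Polynomial.C L * (Polynomial.X * dgE N)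

lemma dg_coeff {ι : Type*} [DecidableEq ι] (s : Finset ι) (a : ι → ℝ) :
    (∏ i ∈ s, (1 + Polynomial.C (a i) * Polynomial.X)).coeff 0 = 1 ∧
    (∏ i ∈ s, (1 + Polynomial.C (a i) * Polynomial.X)).coeff 1 = ∑ i ∈ s, a i ∧
    2 * (∏ i ∈ s, (1 + Polynomial.C (a i) * Polynomial.X)).coeff 2
      = (∑ i ∈ s, a i) ^ 2 - ∑ i ∈ s, a i ^ 2 := by
  induction s using Finset.induction_on with
  | empty => simp [Polynomial.coeff_one]
  | insert i s hi ih =>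
    obtain ⟨h0, h1, h2⟩ := ih
    have c1 := fun p : Polynomial ℝ => Polynomial.coeff_X_mul p 0
    have c2 := fun p : Polynomial ℝ => Polynomial.coeff_X_mul p 1
    simp only [zero_add, Nat.reduceAdd] at c1 c2
    simp only [Finset.prod_insert hi, Finset.sum_insert hi, add_mul, one_mul, mul_assoc,
      Polynomial.coeff_add, Polynomial.coeff_C_mul, Polynomial.coeff_X_mul_zero, c1, c2,
      mul_zero, add_zero]
    refine ⟨h0, ?_, ?_⟩
    · rw [h0, h1]; ring
    · rw [h1]; linear_combination h2

lemma dgQ_coeff (L : ℝ) (N : ℕ) :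
    (dgQ L N).coeff 1 ^ 2 - 2 * (dgQ L N).coeff 2 =
      ((∑ k ∈ Finset.range N, 1 / ((k : ℝ) + 1)) - L) ^ 2
        + 3 * ∑ k ∈ Finset.range N, (1 / ((k : ℝ) + 1)) ^ 2 := by
  obtain ⟨h0, h1, h2⟩ := dg_coeff (Finset.range N) (fun k => 1 / ((k : ℝ) + 1))
  change (dgE N).coeff 0 = _ at h0
  change (dgE N).coeff 1 = _ at h1
  change 2 * (dgE N).coeff 2 = _ at h2
  have e1 : (dgQ L N).coeff 1 = 2 * (dgE N).coeff 1 - L * (dgE N).coeff 0 := by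
    simp only [dgQ, Polynomial.coeff_sub, Polynomial.coeff_C_mul, Polynomial.coeff_derivative]
    rw [Polynomial.coeff_X_mul, Polynomial.coeff_X_mul (dgE N) 0]; push_cast; ring
  have e2 : (dgQ L N).coeff 2 = 3 * (dgE N).coeff 2 - L * (dgE N).coeff 1 := by
    simp only [dgQ, Polynomial.coeff_sub, Polynomial.coeff_C_mul, Polynomial.coeff_derivative]
    rw [Polynomial.coeff_X_mul, Polynomial.coeff_X_mul (dgE N) 1]; push_cast; ring
  rw [e1, e2, h0, h1]
  linear_combination (-3) * h2

lemma dgQ_eval_zero (L : ℝ) (N : ℕ) : (dgQ L N).eval 0 = 1 := by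
  obtain ⟨h0, -, -⟩ := dg_coeff (Finset.range N) (fun k => 1 / ((k : ℝ) + 1))
  change (dgE N).coeff 0 = _ at h0
  rw [Polynomial.coeff_zero_eq_eval_zero] at h0
  simp [dgQ, h0]

lemma dgE_natDegree (N : ℕ) : (dgE N).natDegree ≤ N := by
  refine (Polynomial.natDegree_prod_le _ _).trans ?_
  refine (Finset.sum_le_card_nsmul _ _ 1 ?_).trans (by simp)
  intro k _
  compute_degree

lemma dgQ_natDegree (L : ℝ) (N : ℕ) : (dgQ L N).natDegree ≤ N + 1 := by
  have h : (Polynomial.X * dgE N).natDegree ≤ N + 1 := by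
    refine Polynomial.natDegree_mul_le.trans ?_
    have := dgE_natDegree N
    simp; omega
  refine (Polynomial.natDegree_sub_le _ _).trans (max_le ?_ ?_)
  · exact (Polynomial.natDegree_derivative_le _).trans (by omega)
  · exact (Polynomial.natDegree_C_mul_le _ _).trans h

lemma dg_eval_deriv (N : ℕ) (x : ℝ) (hx : ∀ k : ℕ, x + k ≠ 0) :
    (Polynomial.derivative (Polynomial.X * dgE N)).eval x
      = (Polynomial.X * dgE N).eval x * dgS N x := by
  induction N with
  | zero =>
    have := hx 0
    simp at this
    simp [dgE, dgS, this]
  | succ N ih =>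
    have hE : Polynomial.X * dgE (N + 1) = (Polynomial.X * dgE N) *
        (1 + Polynomial.C (1 / ((N : ℝ) + 1)) * Polynomial.X) := by
      rw [dgE, Finset.prod_range_succ, mul_assoc]; rfl
    have hS : dgS (N + 1) x = dgS N x + 1 / (x + (N + 1)) := by
      simp [dgS, Finset.sum_range_succ _ (N + 1)]
    rw [hE, Polynomial.derivative_mul, Polynomial.eval_add, Polynomial.eval_mul, ih, hS,
      Polynomial.eval_mul, Polynomial.eval_mul (p := Polynomial.X * dgE N)]
    have h1 := hx (N + 1)
    have h2 : (N : ℝ) + 1 ≠ 0 := by positivity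
    push_cast at h1
    simp
    field_simp
    ring

lemma dgQ_eval (L : ℝ) (N : ℕ) (x : ℝ) (hx : ∀ k : ℕ, x + k ≠ 0) :
    (dgQ L N).eval x = (Polynomial.X * dgE N).eval x * (dgS N x - L) := by
  rw [dgQ, Polynomial.eval_sub, dg_eval_deriv N x hx,
    Polynomial.eval_mul (p := Polynomial.C L), Polynomial.eval_C]
  ring

lemma dgG_zero (N k : ℕ) (hk : k ≤ N) : (Polynomial.X * dgE N).eval (-(k : ℝ)) = 0 := by
  rcases k with _ | k
  · simp
  · rw [Polynomial.eval_mul, dgE, Polynomial.eval_prod]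
    rw [Finset.prod_eq_zero (i := k) (by simp; omega)]
    · simp
    · have h2 : (k : ℝ) + 1 ≠ 0 := by positivity
      simp
      field_simp
      ring

lemma dgG_ne (N : ℕ) (x : ℝ) (hx : ∀ k : ℕ, x + k ≠ 0) : (Polynomial.X * dgE N).eval x ≠ 0 := by
  have := hx 0
  simp at this
  rw [Polynomial.eval_mul, dgE, Polynomial.eval_prod]
  refine mul_ne_zero (by simpa) (Finset.prod_ne_zero_iff.2 fun k _ => ?_)
  have h2 : (k : ℝ) + 1 ≠ 0 := by positivity
  have := hx (k + 1)
  push_cast at this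
  simp
  field_simp
  contrapose! this
  linarith

lemma dg_nonpole (k : ℕ) (x : ℝ) (hx : x ∈ Set.Ioo (-(k : ℝ)) (-(k : ℝ) + 1)) :
    ∀ j : ℕ, x + j ≠ 0 := by
  intro j h
  have h1 : (j : ℝ) < k := by linarith [hx.1]
  have h2 : (k : ℝ) < j + 1 := by linarith [hx.2]
  have h1' : j < k := by exact_mod_cast h1
  have h2' : k < j + 1 := by exact_mod_cast h2
  omega

lemma dg_nonpole_pos (x : ℝ) (hx : 0 < x) : ∀ j : ℕ, x + j ≠ 0 := by
  intro j; positivity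

lemma dg_root (L : ℝ) (hL : 0 < L) (N : ℕ) (k : ℕ) (hk : k ≤ N) :
    ∃ r : ℝ, (if k = 0 then 0 < r else r ∈ Set.Ioo (-(k : ℝ)) (-(k : ℝ) + 1)) ∧
      dgS N r = L := by
  by_cases h0 : k = 0
  · simp only [h0, if_true]
    have hM : 0 < ((N : ℝ) + 1) / L := by positivity
    have hc : ContinuousOn (fun x => (dgQ L N).eval x) (Set.Icc 0 (((N : ℝ) + 1) / L)) :=
      (Polynomial.continuous _).continuousOn
    have hG : 0 ≤ (Polynomial.X * dgE N).eval (((N : ℝ) + 1) / L) := by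
      rw [Polynomial.eval_mul, dgE, Polynomial.eval_prod]
      refine mul_nonneg (by simpa using hM.le) (Finset.prod_nonneg fun k _ => ?_)
      simp
      positivity
    have hS : dgS N (((N : ℝ) + 1) / L) ≤ L := by
      have : dgS N (((N : ℝ) + 1) / L) ≤
          ∑ k ∈ Finset.range (N + 1), 1 / (((N : ℝ) + 1) / L) := by
        refine Finset.sum_le_sum fun k _ => ?_
        gcongr
        simp
      refine this.trans (le_of_eq ?_)
      simp
      field_simp
    have hneg : (dgQ L N).eval (((N : ℝ) + 1) / L) ≤ 0 := by
      rw [dgQ_eval _ _ _ (dg_nonpole_pos _ hM)]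
      exact mul_nonpos_of_nonneg_of_nonpos hG (by linarith)
    obtain ⟨r, hr, hr0⟩ := intermediate_value_Icc' hM.le hc
      ⟨hneg, by simp [dgQ_eval_zero]⟩
    have hrpos : 0 < r := by
      rcases hr.1.eq_or_lt with h | h
      · rw [← h] at hr0
        simp [dgQ_eval_zero] at hr0
      · exact h
    refine ⟨r, hrpos, ?_⟩
    have h1 := dgQ_eval L N r (dg_nonpole_pos _ hrpos)
    have h2 := dgG_ne N r (dg_nonpole_pos _ hrpos)
    simp only at hr0
    rw [hr0, zero_eq_mul] at h1
    rcases h1 with h1 | h1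
    · exact absurd h1 h2
    · linarith
  · simp only [h0, if_false]
    have hd : ∀ x, HasDerivAt (fun x => (Polynomial.X * dgE N).eval x * Real.exp (-(L * x)))
        ((dgQ L N).eval x * Real.exp (-(L * x))) x := by
      intro x
      have h1 := (Polynomial.X * dgE N).hasDerivAt x
      have h2 : HasDerivAt (fun x : ℝ => Real.exp (-(L * x))) (Real.exp (-(L * x)) * (-L)) x := by
        have := (((hasDerivAt_id x).const_mul L).neg).exp
        simpa using this
      refine (h1.mul h2).congr_deriv ?_
      rw [dgQ, Polynomial.eval_sub, Polynomial.eval_mul (p := Polynomial.C L), Polynomial.eval_C]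
      ring
    have hb : -(k : ℝ) + 1 = -((k - 1 : ℕ) : ℝ) := by
      rw [Nat.cast_sub (by omega)]; push_cast; ring
    obtain ⟨r, hr, hr0⟩ := exists_hasDerivAt_eq_zero (a := -(k : ℝ)) (b := -(k : ℝ) + 1)
      (by linarith) (fun x _ => (hd x).continuousAt.continuousWithinAt)
      (by rw [dgG_zero N k hk, hb, dgG_zero N (k - 1) (by omega)]; simp)
      (fun x _ => hd x)
    refine ⟨r, hr, ?_⟩
    have h1 := dgQ_eval L N r (dg_nonpole k r hr)
    have h2 := dgG_ne N r (dg_nonpole k r hr)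
    have h3 : (dgQ L N).eval r = 0 := by
      rcases mul_eq_zero.1 hr0 with h | h
      · exact h
      · exact absurd h (Real.exp_ne_zero _)
    rw [h3, zero_eq_mul] at h1
    rcases h1 with h1 | h1
    · exact absurd h1 h2
    · linarith

lemma dg_cmp (N k : ℕ) (hk : k ≤ N) (x y : ℝ)
    (h : ∀ j : ℕ, 0 < (x + j) * (y + j)) :
    |1 / (x + k) - 1 / (y + k)| ≤ |dgS N x - dgS N y| := by
  have hx : ∀ j : ℕ, x + j ≠ 0 := fun j => left_ne_zero_of_mul (h j).ne'
  have hy : ∀ j : ℕ, y + j ≠ 0 := fun j => right_ne_zero_of_mul (h j).ne'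
  have ht : ∀ j : ℕ, 1 / (x + j) - 1 / (y + j) = (y - x) * (1 / ((x + j) * (y + j))) := by
    intro j
    have := hx j
    have := hy j
    field_simp
    ring
  have hs : dgS N x - dgS N y
      = (y - x) * ∑ j ∈ Finset.range (N + 1), 1 / ((x + j) * (y + j)) := by
    rw [dgS, dgS, ← Finset.sum_sub_distrib, Finset.mul_sum]
    exact Finset.sum_congr rfl fun j _ => ht j
  rw [hs, ht, abs_mul, abs_mul]
  gcongr
  · exact (one_div_pos.2 (h k)).le
  · exact Finset.single_le_sum (f := fun j : ℕ => 1 / ((x + j) * (y + j)))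
      (fun j _ => (one_div_pos.2 (h j)).le) (by simp; omega)

lemma dg_same (k : ℕ) (x y : ℝ)
    (hx : if k = 0 then 0 < x else x ∈ Set.Ioo (-(k : ℝ)) (-(k : ℝ) + 1))
    (hy : if k = 0 then 0 < y else y ∈ Set.Ioo (-(k : ℝ)) (-(k : ℝ) + 1)) :
    ∀ j : ℕ, 0 < (x + j) * (y + j) := by
  intro j
  by_cases h0 : k = 0
  · simp only [h0, if_true] at hx hy
    positivity
  · simp only [h0, if_false] at hx hy
    rcases le_or_gt k j with h | h
    · have : (k : ℝ) ≤ j := by exact_mod_cast h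
      exact mul_pos (by linarith [hx.1]) (by linarith [hy.1])
    · have : (j : ℝ) + 1 ≤ k := by exact_mod_cast h
      exact mul_pos_of_neg_of_neg (by linarith [hx.2]) (by linarith [hy.2])

lemma dg_inj (N : ℕ) (r : ℕ → ℝ)
    (hr : ∀ k ≤ N, if k = 0 then 0 < r k else r k ∈ Set.Ioo (-(k : ℝ)) (-(k : ℝ) + 1)) :
    ∀ i ≤ N, ∀ j ≤ N, i < j → r j < r i := by
  intro i hi j hj hij
  have h1 := hr i hi
  have h2 := hr j hj
  have hj0 : j ≠ 0 := by omega
  simp only [hj0, if_false] at h2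
  have : (i : ℝ) + 1 ≤ j := by exact_mod_cast hij
  by_cases h0 : i = 0
  · simp only [h0, if_true] at h1
    subst h0
    push_cast at this
    linarith [h2.2]
  · simp only [h0, if_false] at h1
    linarith [h2.2, h1.1]

lemma dg_ne_zero (k : ℕ) (x : ℝ)
    (hx : if k = 0 then 0 < x else x ∈ Set.Ioo (-(k : ℝ)) (-(k : ℝ) + 1)) : 
    ∀ j : ℕ, x + j ≠ 0 := fun j => left_ne_zero_of_mul (dg_same k x x hx hx j).ne'

lemma dg_sum (L : ℝ) (N : ℕ) (r : ℕ → ℝ)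
    (hr : ∀ k ≤ N, if k = 0 then 0 < r k else r k ∈ Set.Ioo (-(k : ℝ)) (-(k : ℝ) + 1))
    (hS : ∀ k ≤ N, dgS N (r k) = L) :
    ∑ k ∈ Finset.range (N + 1), 1 / r k ^ 2 =
      ((∑ k ∈ Finset.range N, 1 / ((k : ℝ) + 1)) - L) ^ 2
        + 3 * ∑ k ∈ Finset.range N, (1 / ((k : ℝ) + 1)) ^ 2 := by
  have hne : ∀ k ≤ N, r k ≠ 0 := fun k hk => by
    simpa using dg_ne_zero k _ (hr k hk) 0
  have key : dgQ L N = ∏ k ∈ Finset.range (N + 1),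
      (1 + Polynomial.C (-1 / r k) * Polynomial.X) := by
    have hinj : Set.InjOn r (Finset.range (N + 1)) := by
      intro i hi j hj hij
      simp at hi hj
      rcases lt_trichotomy i j with h | h | h
      · exact absurd hij (dg_inj N r hr i (by omega) j (by omega) h).ne'
      · exact h
      · exact absurd hij (dg_inj N r hr j (by omega) i (by omega) h).ne
    have h0 : (0 : ℝ) ∉ (Finset.range (N + 1)).image r := by
      simp
      intro k hk
      exact hne k (by omega)
    have hcard : (insert (0 : ℝ) ((Finset.range (N + 1)).image r)).card = N + 2 := by
      rw [Finset.card_insert_of_notMem h0, Finset.card_image_of_injOn hinj, Finset.card_range]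
    apply Polynomial.eq_of_degrees_lt_of_eval_finset_eq
      (insert (0 : ℝ) ((Finset.range (N + 1)).image r))
    · rw [hcard]
      refine Polynomial.degree_le_natDegree.trans_lt ?_
      have := dgQ_natDegree L N
      exact_mod_cast (by omega : (dgQ L N).natDegree < N + 2)
    · rw [hcard]
      refine Polynomial.degree_le_natDegree.trans_lt ?_
      have : (∏ k ∈ Finset.range (N + 1),
          (1 + Polynomial.C (-1 / r k) * Polynomial.X)).natDegree ≤ N + 1 := by
        refine (Polynomial.natDegree_prod_le _ _).trans ?_
        refine (Finset.sum_le_card_nsmul _ _ 1 ?_).trans (by simp)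
        intro k _
        compute_degree
      exact lt_of_le_of_lt (Nat.cast_le.2 this) (by exact_mod_cast (by omega : N + 1 < N + 2))
    · intro x hx
      rw [Finset.mem_insert, Finset.mem_image] at hx
      rcases hx with rfl | ⟨k, hk, rfl⟩
      · rw [dgQ_eval_zero, Polynomial.eval_prod]
        simp
      · have hk' : k ≤ N := by simp at hk; omega
        rw [dgQ_eval _ _ _ (dg_ne_zero k _ (hr k hk')), hS k hk', Polynomial.eval_prod,
          Finset.prod_eq_zero hk]
        · simp
        · have := hne k hk'
          simp
          field_simp
          ring
  obtain ⟨-, h1, h2⟩ := dg_coeff (Finset.range (N + 1)) (fun k => -1 / r k)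
  rw [← key] at h1 h2
  rw [← dgQ_coeff, h2, h1]
  rw [sub_sub_cancel]
  refine Finset.sum_congr rfl fun k _ => ?_
  rw [div_pow]; norm_num

lemma dg_add_one (x : ℝ) (hx : ∀ j : ℕ, x + j ≠ 0) : digamma (x + 1) = digamma x + 1 / x := by
  have hx' : ∀ m : ℕ, x ≠ -m := fun m h => hx m (by rw [h]; ring)
  have hx0 : x ≠ 0 := by simpa using hx 0
  have hG := Real.Gamma_ne_zero hx'
  have hd := (Real.differentiableAt_Gamma hx').hasDerivAt
  have hx1 : ∀ m : ℕ, x + 1 ≠ -m := fun m h => hx (m + 1) (by push_cast; linarith)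
  have hd1 := (Real.differentiableAt_Gamma hx1).hasDerivAt.comp_add_const x 1
  have hd2 := (hasDerivAt_id x).mul hd
  have he : (fun y => Real.Gamma (y + 1)) =ᶠ[𝓝 x] (id * Real.Gamma) := by
    filter_upwards [isOpen_ne.mem_nhds hx0] with y hy
    simpa using Real.Gamma_add_one hy
  have := hd1.unique (hd2.congr_of_eventuallyEq he)
  rw [digamma, digamma, this, Real.Gamma_add_one hx0]
  simp
  field_simp
  ring

lemma dg_add_nat (x : ℝ) (hx : ∀ j : ℕ, x + j ≠ 0) (N : ℕ) :
    digamma (x + N + 1) = digamma x + dgS N x := by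
  induction N with
  | zero => simpa [dgS] using dg_add_one x hx
  | succ N ih =>
    have h := dg_add_one (x + N + 1) (fun j => by
      have := hx (N + 1 + j)
      push_cast at this
      rwa [add_assoc x, add_assoc x])
    rw [ih] at h
    have hS : dgS (N + 1) x = dgS N x + 1 / (x + N + 1) := by
      simp [dgS, Finset.sum_range_succ _ (N + 1), add_assoc]
    rw [hS]
    push_cast
    rw [← add_assoc x, h]
    ring

lemma dg_hasDeriv (x : ℝ) (hx : 0 < x) : HasDerivAt (Real.log ∘ Real.Gamma) (digamma x) x := by
  have hx' : ∀ m : ℕ, x ≠ -m := fun m h => dg_nonpole_pos x hx m (by rw [h]; ring)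
  exact (Real.differentiableAt_Gamma hx').hasDerivAt.log (Real.Gamma_ne_zero hx')

lemma dg_slope (x : ℝ) (hx : 0 < x) : slope (Real.log ∘ Real.Gamma) x (x + 1) = Real.log x := by
  rw [slope_def_field]
  simp only [Function.comp]
  rw [Real.Gamma_add_one hx.ne', Real.log_mul hx.ne' (Real.Gamma_pos_of_pos hx).ne']
  simp

lemma dg_le_log (x : ℝ) (hx : 0 < x) : digamma x ≤ Real.log x := by
  rw [← dg_slope x hx]
  exact Real.convexOn_log_Gamma.le_slope_of_hasDerivAt hx (show 0 < x + 1 by linarith)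
    (by linarith) (dg_hasDeriv x hx)

lemma log_le_dg (x : ℝ) (hx : 0 < x) : Real.log x ≤ digamma (x + 1) := by
  rw [← dg_slope x hx]
  exact Real.convexOn_log_Gamma.slope_le_of_hasDerivAt hx (show 0 < x + 1 by linarith)
    (by linarith) (dg_hasDeriv (x + 1) (by linarith))

lemma dg_log_lim (c : ℝ) :
    Tendsto (fun N : ℕ => Real.log (c + N) - Real.log N) atTop (𝓝 0) := by
  have h1 : Tendsto (fun N : ℕ => c / N + 1) atTop (𝓝 1) := by
    simpa using (tendsto_const_div_atTop_nhds_zero_nat c).add_const 1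
  have h2 := (Real.continuousAt_log one_ne_zero).tendsto.comp h1
  rw [Real.log_one] at h2
  refine h2.congr' ?_
  filter_upwards [eventually_gt_atTop 0, tendsto_natCast_atTop_atTop.eventually_gt_atTop (-c)]
    with N hN hc
  have hN' : (N : ℝ) ≠ 0 := by positivity
  have hc' : c + N ≠ 0 := by linarith
  rw [Function.comp, ← Real.log_div hc' hN']
  congr 1
  field_simp

lemma dg_tendsto (x : ℝ) (hx : ∀ j : ℕ, x + j ≠ 0) (h0 : digamma x = 0) :
    Tendsto (fun N : ℕ => dgS N x - Real.log N) atTop (𝓝 0) := by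
  refine tendsto_of_tendsto_of_tendsto_of_le_of_le' (dg_log_lim x) (dg_log_lim (x + 1)) ?_ ?_
  · filter_upwards [tendsto_natCast_atTop_atTop.eventually_gt_atTop (-x)] with N hN
    have := log_le_dg (x + N) (by linarith)
    rw [dg_add_nat x hx, h0] at this
    linarith
  · filter_upwards [tendsto_natCast_atTop_atTop.eventually_gt_atTop (-x)] with N hN
    have := dg_le_log (x + N + 1) (by linarith)
    rw [dg_add_nat x hx, h0, show x + N + 1 = x + 1 + N by ring] at this
    linarith

lemma dg_rhs : Tendsto (fun N : ℕ =>
      ((∑ k ∈ Finset.range N, 1 / ((k : ℝ) + 1)) - Real.log N) ^ 2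
        + 3 * ∑ k ∈ Finset.range N, (1 / ((k : ℝ) + 1)) ^ 2) atTop
      (𝓝 (Real.eulerMascheroniConstant ^ 2 + Real.pi ^ 2 / 2)) := by
  have h1 := Real.tendsto_harmonic_sub_log
  have h1' : Tendsto (fun N : ℕ => (∑ k ∈ Finset.range N, 1 / ((k : ℝ) + 1)) - Real.log N) atTop
      (𝓝 Real.eulerMascheroniConstant) := by
    refine h1.congr fun N => ?_
    simp [harmonic]
  have h2 : HasSum (fun k : ℕ => (1 / ((k : ℝ) + 1)) ^ 2) (Real.pi ^ 2 / 6) := by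
    have := (hasSum_nat_add_iff' 1).2 hasSum_zeta_two
    simpa using this
  convert (h1'.pow 2).add (h2.tendsto_sum_nat.const_mul 3) using 2
  ring

/-- The zeros `ρ₀ > 0` and `ρ_n ∈ (-n, -n+1)` (`n ≥ 1`) of the digamma function satisfy
`∑_{n≥0} 1/ρ_n² = γ² + π²/2`. -/
theorem sum_inv_sq_digamma_zeros (ρ : ℕ → ℝ)
    (hzero : ∀ n, digamma (ρ n) = 0) (hpos : 0 < ρ 0)
    (hloc : ∀ n : ℕ, 1 ≤ n → ρ n ∈ Set.Ioo (-(n : ℝ)) (-(n : ℝ) + 1)) :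
    Summable (fun n : ℕ => 1 / ρ n ^ 2) ∧
    ∑' n : ℕ, 1 / ρ n ^ 2
      = Real.eulerMascheroniConstant ^ 2 + Real.pi ^ 2 / 2 := by
  have hρ : ∀ k : ℕ, if k = 0 then 0 < ρ k else ρ k ∈ Set.Ioo (-(k : ℝ)) (-(k : ℝ) + 1) := by
    intro k
    split_ifs with h
    · rwa [h]
    · exact hloc k (by omega)
  have hex : ∀ N k : ℕ, ∃ r : ℝ, 2 ≤ N → k ≤ N →
      (if k = 0 then 0 < r else r ∈ Set.Ioo (-(k : ℝ)) (-(k : ℝ) + 1)) ∧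
        dgS N r = Real.log N := by
    intro N k
    by_cases h : 2 ≤ N ∧ k ≤ N
    · obtain ⟨r, hr⟩ := dg_root (Real.log N) (Real.log_pos (by exact_mod_cast h.1)) N k h.2
      exact ⟨r, fun _ _ => hr⟩
    · exact ⟨0, fun h1 h2 => absurd ⟨h1, h2⟩ h⟩
  choose r hr using hex
  have hρ0 : ∀ k, ρ k ≠ 0 := fun k => by simpa using dg_ne_zero k _ (hρ k) 0
  have hlim : ∀ k, Tendsto (fun N => 1 / r N k ^ 2) atTop (𝓝 (1 / ρ k ^ 2)) := by
    intro k
    have hne := dg_ne_zero k _ (hρ k)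
    have h1 : Tendsto (fun N => 1 / (r N k + k)) atTop (𝓝 (1 / (ρ k + k))) := by
      rw [tendsto_iff_dist_tendsto_zero]
      refine squeeze_zero' (Eventually.of_forall fun _ => dist_nonneg) ?_
        (by simpa using (dg_tendsto (ρ k) hne (hzero k)).abs)
      filter_upwards [eventually_ge_atTop 2, eventually_ge_atTop k] with N h2 hk
      obtain ⟨ha, hb⟩ := hr N k h2 hk
      have := dg_cmp N k hk (ρ k) (r N k) (dg_same k _ _ (hρ k) ha)
      rw [hb] at this
      rw [dist_comm, Real.dist_eq]
      exact this
    have h2 : Tendsto (fun N => r N k) atTop (𝓝 (ρ k)) := by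
      have := (h1.inv₀ (one_div_ne_zero (hne k))).sub_const (k : ℝ)
      simpa using this
    exact tendsto_const_nhds.div (h2.pow 2) (pow_ne_zero 2 (hρ0 k))
  have hbd : ∀ (k : ℕ) (x : ℝ), 2 ≤ k → x ∈ Set.Ioo (-(k : ℝ)) (-(k : ℝ) + 1) →
      1 / x ^ 2 ≤ 1 / ((k : ℝ) - 1) ^ 2 := by
    intro k x hk hx
    have hk' : (2 : ℝ) ≤ k := by exact_mod_cast hk
    rw [← neg_sq x]
    have : 0 < (k : ℝ) - 1 := by linarith
    gcongr
    linarith [hx.2]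
  set bound : ℕ → ℝ := fun k => if k < 2 then 1 / ρ k ^ 2 + 1 else 1 / ((k : ℝ) - 1) ^ 2
    with hbound
  have hbs : Summable bound := by
    rw [← summable_nat_add_iff 2]
    have : Summable (fun k : ℕ => 1 / (((k + 1 : ℕ) : ℝ)) ^ 2) :=
      (summable_nat_add_iff 1).2 (Real.summable_one_div_nat_pow.2 one_lt_two)
    refine this.congr fun k => ?_
    simp [hbound]
    ring_nf
  have hs : Summable (fun n : ℕ => 1 / ρ n ^ 2) := by
    refine Summable.of_nonneg_of_le (fun k => by positivity) (fun k => ?_) hbs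
    simp only [hbound]
    split_ifs with h
    · linarith
    · exact hbd k _ (by omega) (hloc k (by omega))
  refine ⟨hs, ?_⟩
  set f : ℕ → ℕ → ℝ := fun N k => if k ≤ N then 1 / r N k ^ 2 else 0 with hf
  have hfl : ∀ k, Tendsto (fun N => f N k) atTop (𝓝 (1 / ρ k ^ 2)) := by
    intro k
    refine (hlim k).congr' ?_
    filter_upwards [eventually_ge_atTop k] with N hk
    simp [hf, hk]
  have hT : Tendsto (fun N => ∑' k, f N k) atTop (𝓝 (∑' k, 1 / ρ k ^ 2)) := by
    refine tendsto_tsum_of_dominated_convergence hbs hfl ?_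
    filter_upwards [eventually_ge_atTop 2,
      (hfl 0).eventually_le_const (lt_add_one _),
      (hfl 1).eventually_le_const (lt_add_one _)] with N h2 ha hb k
    have hnn : 0 ≤ f N k := by
      simp only [hf]; split_ifs <;> positivity
    rw [Real.norm_of_nonneg hnn]
    by_cases hk : k < 2
    · simp only [hbound, hk, if_true]
      interval_cases k
      · exact ha
      · exact hb
    · simp only [hbound, hk, if_false, hf]
      split_ifs with hkN
      · have := (hr N k h2 hkN).1
        rw [if_neg (by omega)] at this
        exact hbd k _ (by omega) this
      · positivity
  refine tendsto_nhds_unique hT (dg_rhs.congr' ?_)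
  filter_upwards [eventually_ge_atTop 2] with N h2
  rw [← dg_sum (Real.log N) N (r N) (fun k hk => (hr N k h2 hk).1) (fun k hk => (hr N k h2 hk).2)]
  rw [tsum_eq_sum (s := Finset.range (N + 1))]
  · refine Finset.sum_congr rfl fun k hk => ?_
    have : k ≤ N := by simp at hk; omega
    simp [hf, this]
  · intro k hk
    have : ¬ k ≤ N := by simp at hk; omega
    simp [hf, this]
end

section
/- Let Ein(t) = ∑_{k=1}^∞ (−1)^{k+1} t^k/(k·k!) (the complementary exponential integral). Then, as x → +∞ along the reals, ∫₀^x (Ein(t)/t) dt − ((1/2)·(ln x)² + γ·ln x) converges to γ²/2 + π²/12, where γ is the Euler–Mascheroni constant. -/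
open Real

/-- The complementary exponential integral `Ein(t) = ∑_{k≥1} (-1)^{k+1} t^k/(k·k!)`. -/
noncomputable def Ein (t : ℝ) : ℝ :=
  ∑' k : ℕ, (-1) ^ k * t ^ (k + 1) / (((k : ℝ) + 1) * (Nat.factorial (k + 1) : ℝ))

open Filter Topology

lemma Ein_summ_exp (t : ℝ) : HasSum (fun k : ℕ => (-1) ^ k * t ^ (k+1) / ((k+1).factorial : ℝ)) (1 - Real.exp (-t)) := by
  have h := NormedSpace.expSeries_div_hasSum_exp (𝔸 := ℝ) (-t)
  rw [← Real.exp_eq_exp_ℝ] at h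
  have h2 := (hasSum_nat_add_iff' 1).mpr h
  have h3 := h2.neg
  simp only [Finset.sum_range_one, pow_zero, Nat.factorial_zero, Nat.cast_one, div_one, neg_sub] at h3
  have e : (fun k : ℕ => (-1) ^ k * t ^ (k+1) / ((k+1).factorial : ℝ)) = fun k : ℕ => -((-t) ^ (k + 1) / ((k + 1).factorial : ℝ)) := by
    funext k
    rw [neg_pow t, pow_succ (-1:ℝ)]; ring
  rw [e]; exact h3

lemma Ein_zero : Ein 0 = 0 := by simp [Ein]

lemma Ein_hasDerivAt (t : ℝ) : HasDerivAt Ein (∑' k : ℕ, (-1) ^ k * t ^ k / ((k+1).factorial : ℝ)) t := by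
  refine hasDerivAt_tsum_of_isPreconnected (𝕜 := ℝ) (F := ℝ) (g := fun (k : ℕ) (t : ℝ) => (-1) ^ k * t ^ (k + 1) / (((k : ℝ) + 1) * (Nat.factorial (k + 1) : ℝ))) (g' := fun (k : ℕ) (t : ℝ) => (-1) ^ k * t ^ k / ((k+1).factorial : ℝ)) (u := fun k : ℕ => (|t|+1)^k / (k.factorial : ℝ))
    (t := Metric.ball (0:ℝ) (|t|+1)) (y₀ := 0) (Real.summable_pow_div_factorial _) Metric.isOpen_ball
    (convex_ball _ _).isPreconnected ?_ ?_ ?_ ?_ ?_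
  · intro k y _
    have h := ((hasDerivAt_pow (k+1) y).const_mul ((-1:ℝ)^k)).div_const (((k : ℝ) + 1) * (Nat.factorial (k + 1) : ℝ))
    refine h.congr_deriv ?_
    have : (k:ℝ)+1 ≠ 0 := by positivity
    have : ((k+1).factorial:ℝ) ≠ 0 := by positivity
    push_cast
    field_simp
  · intro k y hy
    have hy' : |y| ≤ |t|+1 := by simpa using (Metric.mem_ball.mp hy).le
    rw [norm_div, norm_mul, norm_pow, norm_pow]
    simp only [norm_neg, norm_one, one_pow, one_mul, Real.norm_eq_abs, Nat.abs_cast]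
    gcongr
    omega
  · simp; positivity
  · simp [summable_zero]
  · simp

lemma Ein_deriv_eq {t : ℝ} (ht : t ≠ 0) : HasDerivAt Ein ((1 - Real.exp (-t)) / t) t := by
  refine (Ein_hasDerivAt t).congr_deriv ?_
  rw [← (Ein_summ_exp t).tsum_eq, ← tsum_div_const]
  congr 1; ext k; field_simp; ring

/-- continuous version of `Ein t / t` -/
noncomputable def EB : ℝ → ℝ := dslope Ein 0

lemma EB_cont : Continuous EB := by
  have h : Differentiable ℝ Ein := fun t => (Ein_hasDerivAt t).differentiableAt
  rw [continuous_iff_continuousAt]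
  intro t
  rcases eq_or_ne t 0 with rfl | ht
  · exact continuousAt_dslope_same.mpr (h 0)
  · exact (continuousAt_dslope_of_ne ht).mpr (h t).continuousAt

lemma EB_eq {t : ℝ} (ht : t ≠ 0) : EB t = Ein t / t := by
  rw [EB, dslope_of_ne _ ht, slope_def_field, Ein_zero, sub_zero, sub_zero]

lemma int_eq (x : ℝ) (hx : 0 ≤ x) : ∫ t in (0:ℝ)..x, Ein t / t = ∫ t in (0:ℝ)..x, EB t := by
  apply intervalIntegral.integral_congr_ae
  refine Eventually.of_forall fun t ht => ?_
  rw [Set.uIoc_of_le hx] at ht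
  rw [EB_eq ht.1.ne']

/-- generic comparison -/
lemma comp_le {f g f' g' : ℝ → ℝ} (b : ℝ) (hb : 0 ≤ b) (hf : Continuous f) (hg : ContinuousOn g (Set.Icc 0 b))
    (h0 : f 0 = g 0)
    (hf' : ∀ t, 0 < t → t < b → HasDerivAt f (f' t) t) (hg' : ∀ t, 0 < t → t < b → HasDerivAt g (g' t) t)
    (h : ∀ t, 0 < t → t < b → f' t ≤ g' t) : f b ≤ g b := by
  have hm : MonotoneOn (fun t => g t - f t) (Set.Icc 0 b) := by
    refine monotoneOn_of_hasDerivWithinAt_nonneg (f' := fun t => g' t - f' t) (convex_Icc 0 b) (hg.sub hf.continuousOn) ?_ ?_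
    · intro x hx
      rw [interior_Icc] at hx
      exact ((hg' x hx.1 hx.2).sub (hf' x hx.1 hx.2)).hasDerivWithinAt
    · intro x hx
      rw [interior_Icc] at hx
      exact sub_nonneg.mpr (h x hx.1 hx.2)
  have := hm (Set.left_mem_Icc.mpr hb) (Set.right_mem_Icc.mpr hb) hb
  simp only [h0, sub_self] at this
  linarith

lemma Ein_cont : Continuous Ein := by
  have h : Differentiable ℝ Ein := fun t => (Ein_hasDerivAt t).differentiableAt
  exact h.continuous

lemma Ein_nonneg {t : ℝ} (ht : 0 ≤ t) : 0 ≤ Ein t := by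
  refine comp_le (f := fun _ => 0) (f' := fun _ => 0) (g := Ein) (g' := fun t => (1 - Real.exp (-t)) / t) t ht continuous_const Ein_cont.continuousOn Ein_zero.symm
    (fun s _ _ => hasDerivAt_const _ _) (fun s hs _ => Ein_deriv_eq hs.ne') ?_
  intro s hs _
  have : Real.exp (-s) ≤ 1 := Real.exp_le_one_iff.mpr (by linarith)
  exact div_nonneg (by linarith) hs.le

lemma Ein_le {t : ℝ} (ht : 0 ≤ t) : Ein t ≤ 2 * Real.log (1 + t) := by
  refine comp_le (f := Ein) (f' := fun t => (1 - Real.exp (-t)) / t) (g := fun t => 2 * Real.log (1 + t)) (g' := fun t => 2 * (1 / (1 + t))) t ht Ein_cont ?_ (by simp [Ein_zero])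
    (fun s hs _ => Ein_deriv_eq hs.ne') ?_ ?_
  · refine ContinuousOn.mul continuousOn_const (ContinuousOn.log (by fun_prop) ?_)
    intro x hx; have := hx.1; positivity
  · intro s hs _
    exact (((hasDerivAt_id s).const_add 1).log (by simp; positivity)).const_mul 2
  · intro s hs _
    have h1 : 1 - Real.exp (-s) ≤ s := by have := Real.add_one_le_exp (-s); linarith
    have h2 : 1 - Real.exp (-s) ≤ 1 := by have := Real.exp_pos (-s); linarith
    rw [mul_one_div, div_le_div_iff₀ hs (by positivity)]
    rcases le_total s 1 with h | h <;> nlinarith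

/-- the discrete approximant -/
noncomputable def En (n : ℕ) (t : ℝ) : ℝ := ∑ k ∈ Finset.range n, (1 - (1 - t / n) ^ (k+1)) / ((k:ℝ) + 1)

noncomputable def Qn (n : ℕ) (t : ℝ) : ℝ :=
  ∑ k ∈ Finset.range n, (1 / ((k:ℝ) + 1)) * ∑ j ∈ Finset.range (k+1), (1 - t / n) ^ j / n

lemma En_eq (n : ℕ) (hn : 0 < n) (t : ℝ) : En n t = t * Qn n t := by
  unfold En Qn
  rw [Finset.mul_sum]
  refine Finset.sum_congr rfl fun k _ => ?_
  have h := mul_neg_geom_sum (1 - t / n) (k+1)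
  rw [← Finset.sum_div, ← h]
  have : (n:ℝ) ≠ 0 := by positivity
  field_simp
  ring

lemma En_deriv (n : ℕ) (hn : 0 < n) {t : ℝ} (ht : t ≠ 0) : HasDerivAt (En n) ((1 - (1 - t / n) ^ n) / t) t := by
  have hn' : (n:ℝ) ≠ 0 := by positivity
  have h : HasDerivAt (En n) (∑ k ∈ Finset.range n, (1 - t / n) ^ k / n) t := by
    unfold En
    refine HasDerivAt.fun_sum fun k _ => ?_
    have h1 : HasDerivAt (fun t : ℝ => 1 - t / n) (-(1 / n)) t := ((hasDerivAt_id t).div_const (n:ℝ)).const_sub 1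
    refine (((h1.pow (k+1)).const_sub 1).div_const ((k:ℝ)+1)).congr_deriv ?_
    have : (k:ℝ)+1 ≠ 0 := by positivity
    push_cast
    field_simp
  refine h.congr_deriv ?_
  have h := mul_neg_geom_sum (1 - t / n) n
  rw [← Finset.sum_div, ← h]
  field_simp
  ring

lemma exp_bd (n : ℕ) (hn : 0 < n) {t : ℝ} (ht : 0 ≤ t) (htn : t ≤ n) :
    Real.exp (-t) - (1 - t / n) ^ n ≤ t^2 * Real.exp (-t) / n := by
  have hn' : (0:ℝ) < n := by positivity
  have h0 : 0 ≤ 1 - t / n := by rw [sub_nonneg, div_le_one hn']; exact htn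
  have h1 : 1 - t^2/n ≤ (1 - t / n) ^ n * Real.exp t := by
    have e : Real.exp t = Real.exp (t / n) ^ n := by
      rw [← Real.exp_nat_mul]; congr 1; field_simp
    rw [e, ← mul_pow]
    have h2 : 1 + -(t/n)^2 ≤ (1 - t/n) * Real.exp (t/n) := by
      have := Real.add_one_le_exp (t/n)
      nlinarith
    have h3 : (0:ℝ) ≤ 1 + -(t/n)^2 := by
      have : 0 ≤ t / n := by positivity
      nlinarith
    calc 1 - t^2/n = 1 + n * (-(t/n)^2) := by field_simp; ring
      _ ≤ (1 + -(t/n)^2)^n := one_add_mul_le_pow (by linarith) n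
      _ ≤ _ := by gcongr
  have h4 := mul_le_mul_of_nonneg_right h1 (Real.exp_pos (-t)).le
  rw [mul_assoc, ← Real.exp_add] at h4
  simp only [add_neg_cancel, Real.exp_zero, mul_one] at h4
  have : t^2 * Real.exp (-t) / n = t^2/n * Real.exp (-t) := by ring
  rw [this]; linarith

lemma En_zero (n : ℕ) : En n 0 = 0 := by simp [En]

lemma En_cont (n : ℕ) : Continuous (En n) := by unfold En; fun_prop
lemma Qn_cont (n : ℕ) : Continuous (Qn n) := by unfold Qn; fun_prop

lemma Ein_le_En (n : ℕ) (hn : 0 < n) {t : ℝ} (ht : 0 ≤ t) (htn : t ≤ n) : Ein t ≤ En n t := by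
  refine comp_le (f' := fun t => (1 - Real.exp (-t)) / t) (g' := fun t => (1 - (1 - t / n) ^ n) / t) t ht Ein_cont (En_cont n).continuousOn (by rw [Ein_zero, En_zero])
    (fun s hs _ => Ein_deriv_eq hs.ne') (fun s hs _ => En_deriv n hn hs.ne') ?_
  intro s hs hst
  have := Real.one_sub_div_pow_le_exp_neg (n := n) (t := s) (by linarith)
  gcongr

lemma En_sub_le (n : ℕ) (hn : 0 < n) {t : ℝ} (ht : 0 ≤ t) (htn : t ≤ n) :
    En n t - Ein t ≤ (1 - (1 + t) * Real.exp (-t)) / n := by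
  refine comp_le (f := fun t => En n t - Ein t) (g := fun t => (1 - (1 + t) * Real.exp (-t)) / n)
    (f' := fun t => (1 - (1 - t / n) ^ n) / t - (1 - Real.exp (-t)) / t) (g' := fun t => t * Real.exp (-t) / n) t ht ((En_cont n).sub Ein_cont) (by fun_prop) (by simp [Ein_zero, En_zero])
    (fun s hs _ => (En_deriv n hn hs.ne').sub (Ein_deriv_eq hs.ne')) ?_ ?_
  · intro s hs _
    have h1 : HasDerivAt (fun t : ℝ => Real.exp (-t)) (-Real.exp (-s)) s := by
      simpa using (hasDerivAt_neg s).exp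
    refine (((((hasDerivAt_id s).const_add 1).mul h1).const_sub 1).div_const (n:ℝ)).congr_deriv ?_
    simp
    ring
  · intro s hs hst
    have := exp_bd n hn hs.le (by linarith)
    rw [← sub_div, div_le_iff₀ hs]
    have e : s * Real.exp (-s) / n * s = s^2 * Real.exp (-s) / n := by ring
    rw [e]; linarith

lemma Qn_sub (n : ℕ) (hn : 0 < n) {t : ℝ} (ht : 0 < t) (htn : t ≤ n) :
    0 ≤ Qn n t - EB t ∧ Qn n t - EB t ≤ (2 / n) * (1 / (1 + t)) := by
  have hn' : (0:ℝ) < n := by positivity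
  have e : Qn n t - EB t = (En n t - Ein t) / t := by
    rw [EB_eq ht.ne', En_eq n hn]; field_simp
  rw [e]
  have h1 := Ein_le_En n hn ht.le htn
  have h2 := En_sub_le n hn ht.le htn
  refine ⟨div_nonneg (by linarith) ht.le, ?_⟩
  set A := 1 - (1 + t) * Real.exp (-t) with hA
  have hA1 : A ≤ 1 := by rw [hA]; have := Real.exp_pos (-t); nlinarith
  have hA2 : A ≤ t := by
    have := Real.add_one_le_exp (-t); have := Real.exp_pos (-t); rw [hA]; nlinarith
  rw [div_le_iff₀ ht]
  refine h2.trans ?_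
  have : A ≤ 2 * t / (1 + t) := by
    rw [le_div_iff₀ (by positivity)]
    rcases le_total t 1 with h | h <;> nlinarith
  calc A / n ≤ (2 * t / (1 + t)) / n := by gcongr
    _ = _ := by field_simp

lemma int_inv (n : ℕ) : ∫ t in (0:ℝ)..n, (1 / (1 + t)) = Real.log (1 + n) := by
  rw [intervalIntegral.integral_eq_sub_of_hasDerivAt_of_le (f := fun t => Real.log (1 + t)) (by positivity)]
  · simp
  · refine (ContinuousOn.log (by fun_prop) ?_)
    intro x hx; have := hx.1; positivity
  · intro s hs
    have := hs.1
    exact (((hasDerivAt_id s).const_add 1).log (by simp; positivity))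
  · apply ContinuousOn.intervalIntegrable
    refine ContinuousOn.div (by fun_prop) (by fun_prop) ?_
    intro x hx
    rw [Set.uIcc_of_le (by positivity)] at hx
    have := hx.1; positivity

lemma int_Qn (n : ℕ) (hn : 0 < n) : ∫ t in (0:ℝ)..n, Qn n t =
    ∑ k ∈ Finset.range n, (1 / ((k:ℝ) + 1)) * ∑ j ∈ Finset.range (k+1), 1 / ((j:ℝ)+1) := by
  have hn' : (n:ℝ) ≠ 0 := by positivity
  unfold Qn
  rw [intervalIntegral.integral_finsetSum (fun i _ => Continuous.intervalIntegrable (by fun_prop) _ _)]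
  refine Finset.sum_congr rfl fun k _ => ?_
  rw [intervalIntegral.integral_const_mul, intervalIntegral.integral_finsetSum (fun i _ => Continuous.intervalIntegrable (by fun_prop) _ _)]
  congr 1
  refine Finset.sum_congr rfl fun j _ => ?_
  rw [intervalIntegral.integral_eq_sub_of_hasDerivAt (f := fun t => - (1 - t / n) ^ (j+1) / ((j:ℝ)+1))]
  · simp [hn']
    ring
  · intro t _
    have h1 : HasDerivAt (fun t : ℝ => 1 - t / n) (-(1 / n)) t := ((hasDerivAt_id t).div_const (n:ℝ)).const_sub 1
    refine (((h1.pow (j+1)).neg).div_const ((j:ℝ)+1)).congr_deriv ?_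
    have : (j:ℝ)+1 ≠ 0 := by positivity
    push_cast
    field_simp
  · exact Continuous.intervalIntegrable (by fun_prop) _ _

lemma sum_id (n : ℕ) : ∑ k ∈ Finset.range n, (1 / ((k:ℝ) + 1)) * ∑ j ∈ Finset.range (k+1), 1 / ((j:ℝ)+1)
    = ((harmonic n : ℝ)^2 + ∑ k ∈ Finset.range n, 1 / ((k:ℝ)+1)^2) / 2 := by
  have hH : ∀ n, (harmonic n : ℝ) = ∑ j ∈ Finset.range n, 1 / ((j:ℝ)+1) := by
    intro n; simp [harmonic]
  induction n with
  | zero => simp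
  | succ n ih =>
    rw [Finset.sum_range_succ, ih, hH, hH, Finset.sum_range_succ (fun j : ℕ => 1 / ((j:ℝ)+1)), Finset.sum_range_succ (fun j : ℕ => 1 / ((j:ℝ)+1)^2)]
    field_simp
    ring

lemma tend_log_div : Tendsto (fun x : ℝ => Real.log x / x) atTop (𝓝 0) := by
  simpa using Real.isLittleO_log_id_atTop.tendsto_div_nhds_zero

lemma tend_log1_div : Tendsto (fun x : ℝ => Real.log (1 + x) / x) atTop (𝓝 0) := by
  have h1 : Tendsto (fun x : ℝ => 1 + x) atTop atTop := tendsto_atTop_add_const_left _ _ tendsto_id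
  have h2 := (tend_log_div.comp h1).const_mul 2
  simp only [mul_zero] at h2
  refine squeeze_zero' ?_ ?_ h2
  · filter_upwards [eventually_ge_atTop 1] with x hx
    exact div_nonneg (Real.log_nonneg (by linarith)) (by linarith)
  · filter_upwards [eventually_ge_atTop 1] with x hx
    have := Real.log_nonneg (show 1 ≤ 1 + x by linarith)
    simp only [Function.comp]
    rw [← mul_div_assoc, div_le_div_iff₀ (by linarith) (by linarith)]
    nlinarith

lemma harm_lim : Tendsto (fun n : ℕ => (harmonic n : ℝ)^2 / 2 - ((Real.log n)^2/2 + Real.eulerMascheroniConstant * Real.log n)) atTop (𝓝 (Real.eulerMascheroniConstant^2/2)) := by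
  set γ := Real.eulerMascheroniConstant
  set d : ℕ → ℝ := fun n => harmonic n - Real.log n - γ with hd
  have hd0 : Tendsto d atTop (𝓝 0) := by
    have := Real.tendsto_harmonic_sub_log.sub_const γ
    rwa [sub_self] at this
  have hdl : Tendsto (fun n : ℕ => d n * Real.log n) atTop (𝓝 0) := by
    refine squeeze_zero' ?_ ?_ (tend_log_div.comp tendsto_natCast_atTop_atTop)
    · filter_upwards [eventually_gt_atTop 0] with n hn
      have := Real.eulerMascheroniConstant_lt_eulerMascheroniSeq' n
      rw [Real.eulerMascheroniSeq', if_neg hn.ne'] at this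
      exact mul_nonneg (by simp only [hd]; linarith) (Real.log_natCast_nonneg n)
    · filter_upwards [eventually_gt_atTop 0] with n hn
      have := Real.eulerMascheroniSeq_lt_eulerMascheroniConstant n
      rw [Real.eulerMascheroniSeq] at this
      have hn' : (0:ℝ) < n := by positivity
      have h2 : Real.log (n+1) - Real.log n ≤ 1 / n := by
        rw [← Real.log_div (by positivity) (by positivity)]
        refine (Real.log_le_sub_one_of_pos (by positivity)).trans (le_of_eq ?_)
        field_simp; ring
      have h3 : d n ≤ 1 / n := by simp only [hd]; linarith
      simp only [Function.comp]
      calc d n * Real.log n ≤ 1 / n * Real.log n := mul_le_mul_of_nonneg_right h3 (Real.log_natCast_nonneg n)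
        _ = _ := by ring
  have := ((hdl.add (hd0.mul_const γ)).add ((hd0.pow 2).div_const 2)).add_const (γ^2/2)
  simp only [zero_mul, add_zero, zero_add, ne_eq, OfNat.ofNat_ne_zero, not_false_eq_true, zero_pow, zero_div] at this
  refine this.congr fun n => ?_
  simp only [hd]; ring

lemma zeta_lim : Tendsto (fun n : ℕ => ∑ k ∈ Finset.range n, 1 / ((k:ℝ)+1)^2) atTop (𝓝 (π^2/6)) := by
  have h := (hasSum_nat_add_iff' 1).mpr hasSum_zeta_two
  simpa using h.tendsto_sum_nat

lemma nat_lim : Tendsto (fun n : ℕ => (∫ t in (0:ℝ)..n, EB t) - ((Real.log n)^2/2 + Real.eulerMascheroniConstant * Real.log n)) atTop (𝓝 (Real.eulerMascheroniConstant^2/2 + π^2/12)) := by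
  have hdiff : Tendsto (fun n : ℕ => (∫ t in (0:ℝ)..n, Qn n t) - ∫ t in (0:ℝ)..n, EB t) atTop (𝓝 0) := by
    have hl := (tend_log1_div.comp (tendsto_natCast_atTop_atTop (R := ℝ))).const_mul 2
    rw [mul_zero] at hl
    have e : ∀ n : ℕ, (∫ t in (0:ℝ)..n, Qn n t) - ∫ t in (0:ℝ)..n, EB t = ∫ t in (0:ℝ)..n, (Qn n t - EB t) := fun n =>
      (intervalIntegral.integral_sub ((Qn_cont n).intervalIntegrable _ _) (EB_cont.intervalIntegrable _ _)).symm
    simp only [e]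
    refine squeeze_zero' ?_ ?_ hl
    · filter_upwards [eventually_gt_atTop 0] with n hn
      rw [intervalIntegral.integral_of_le (by positivity)]
      exact MeasureTheory.setIntegral_nonneg measurableSet_Ioc fun t ht => (Qn_sub n hn ht.1 ht.2).1
    · filter_upwards [eventually_gt_atTop 0] with n hn
      have hn' : (0:ℝ) < n := by positivity
      have h1 : ∫ t in (0:ℝ)..n, (Qn n t - EB t) ≤ ∫ t in (0:ℝ)..n, (2 / n) * (1 / (1 + t)) := by
        refine intervalIntegral.integral_mono_on_of_le_Ioo hn'.le (((Qn_cont n).sub EB_cont).intervalIntegrable _ _) ?_ ?_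
        · apply ContinuousOn.intervalIntegrable
          refine continuousOn_const.mul (ContinuousOn.div (by fun_prop) (by fun_prop) ?_)
          intro x hx
          rw [Set.uIcc_of_le (by positivity)] at hx
          have := hx.1; positivity
        · intro t ht
          exact (Qn_sub n hn ht.1 ht.2.le).2
      refine h1.trans (le_of_eq ?_)
      rw [intervalIntegral.integral_const_mul, int_inv]
      simp only [Function.comp]; ring
  have := (harm_lim.add (zeta_lim.div_const 2)).sub hdiff
  have e : Real.eulerMascheroniConstant^2/2 + π^2/12 = Real.eulerMascheroniConstant^2/2 + π^2/6/2 - 0 := by ring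
  rw [e]
  refine this.congr' ?_
  filter_upwards [eventually_gt_atTop 0] with n hn
  rw [int_Qn n hn, sum_id]; ring

noncomputable def gg (x : ℝ) : ℝ := (∫ t in (0:ℝ)..x, EB t) - ((Real.log x)^2/2 + Real.eulerMascheroniConstant * Real.log x)

lemma gg_deriv {x : ℝ} (hx : 0 < x) : HasDerivAt gg (Ein x / x - (Real.log x / x + Real.eulerMascheroniConstant / x)) x := by
  have h1 : HasDerivAt (fun x => ∫ t in (0:ℝ)..x, EB t) (EB x) x :=
    intervalIntegral.integral_hasDerivAt_right (EB_cont.intervalIntegrable _ _) EB_cont.stronglyMeasurable.stronglyMeasurableAtFilter EB_cont.continuousAt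
  have h2 := Real.hasDerivAt_log hx.ne'
  refine (h1.sub (((h2.pow 2).div_const 2).add (h2.const_mul Real.eulerMascheroniConstant))).congr_deriv ?_
  rw [EB_eq hx.ne']
  simp; ring

lemma gg_deriv_lim : Tendsto (fun x : ℝ => Ein x / x - (Real.log x / x + Real.eulerMascheroniConstant / x)) atTop (𝓝 0) := by
  have h1 : Tendsto (fun x : ℝ => Ein x / x) atTop (𝓝 0) := by
    have hl := tend_log1_div.const_mul 2
    rw [mul_zero] at hl
    refine squeeze_zero' ?_ ?_ hl
    · filter_upwards [eventually_gt_atTop 0] with x hx using div_nonneg (Ein_nonneg hx.le) hx.le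
    · filter_upwards [eventually_gt_atTop 0] with x hx
      rw [← mul_div_assoc]
      have := Ein_le hx.le
      gcongr
  simpa using h1.sub (tend_log_div.add (tendsto_const_nhds.div_atTop tendsto_id))

lemma gg_diff : Tendsto (fun x : ℝ => gg x - gg (⌊x⌋₊ : ℝ)) atTop (𝓝 0) := by
  rw [Metric.tendsto_atTop]
  intro ε hε
  obtain ⟨N, hN⟩ := (Metric.tendsto_atTop.mp gg_deriv_lim) (ε/2) (by positivity)
  refine ⟨max N 1 + 1, fun x hx => ?_⟩
  have hf : (⌊x⌋₊:ℝ) ≤ x := Nat.floor_le (by have := le_max_right N 1; linarith)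
  have hf2 : x < ⌊x⌋₊ + 1 := Nat.lt_floor_add_one x
  have hN1 : ∀ y ∈ Set.Icc (⌊x⌋₊:ℝ) x, N ≤ y ∧ 1 ≤ y := by
    intro y hy
    have := hy.1; have := le_max_right N 1; have := le_max_left N 1
    constructor <;> linarith
  have := (convex_Icc (⌊x⌋₊:ℝ) x).norm_image_sub_le_of_norm_hasDerivWithin_le (f := gg) (C := ε/2)
    (fun y hy => (gg_deriv (by linarith [(hN1 y hy).2])).hasDerivWithinAt)
    (fun y hy => by have := hN y (hN1 y hy).1; rw [dist_zero_right] at this; exact this.le)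
    (Set.left_mem_Icc.mpr hf) (Set.right_mem_Icc.mpr hf)
  rw [dist_zero_right]
  refine this.trans_lt ?_
  rw [Real.norm_eq_abs, abs_of_nonneg (by linarith)]
  nlinarith

/-- Asymptotic of Remark 3.2: as `x → ∞`,
`∫₀ˣ Ein(t)/t dt - ((ln x)²/2 + γ ln x) → γ²/2 + π²/12`. -/
theorem integral_Ein_div_asymptotic :
    Filter.Tendsto
      (fun x : ℝ => (∫ t in (0 : ℝ)..x, Ein t / t)
        - ((Real.log x) ^ 2 / 2 + Real.eulerMascheroniConstant * Real.log x))
      Filter.atTop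
      (nhds (Real.eulerMascheroniConstant ^ 2 / 2 + Real.pi ^ 2 / 12)) := by
  have h := gg_diff.add (nat_lim.comp (tendsto_nat_floor_atTop (α := ℝ)))
  rw [zero_add] at h
  refine h.congr' ?_
  filter_upwards [eventually_gt_atTop 0] with x hx
  rw [int_eq x hx.le]
  simp only [Function.comp, gg]
  ring
end
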